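/- Let Ω ⊂ ℂ be a bounded domain with boundary of class C^{1+ε}, 0 < ε < 1, and let n ≥ 1 be an integer. Define P(f)(z) = ∫_Ω K_n(z,ζ) f(ζ) dA(ζ) for z ∈ Ω, where K_n(z,ζ) = ∫_{ℂ∖Ω} (z−w)^{−2} · n (conj(w−ζ))^{n−1} (w−ζ)^{−(n+1)} dA(w). Then for every 0 < α < ε and every bounded measurable f : Ω → ℂ one has ‖P(f)‖_{α,Ω} ≤ C ‖f‖_{L^∞(Ω)}, where C depends only on n, α, ε and Ω. -/

import Mathlib

open MeasureTheory Metric Set Filter Topology Complex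
open scoped ENNReal NNReal

noncomputable section

/-- `Ω ⊆ ℂ` has boundary of class `C^{1+ε}`: near each boundary point, after a rotation of
coordinates, `Ω` is the subgraph of a `C^1` function whose derivative is `ε`-Hölder. -/
def HasC1HolderBoundaryC (ε : ℝ) (Ω : Set ℂ) : Prop :=
  ∀ a ∈ frontier Ω, ∃ r > 0, ∃ e : ℂ, ‖e‖ = 1 ∧ ∃ φ : ℝ → ℝ,
    ContDiff ℝ 1 φ ∧
    (∃ c : ℝ≥0, HolderOnWith c ε.toNNReal (deriv φ) univ) ∧
    Ω ∩ ball a r = {z ∈ ball a r | (e * z).im < φ ((e * z).re)}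

/-- The kernel `K_n(z,ζ) = ∫_{ℂ∖Ω} (z−w)^{−2} · n conj(w−ζ)^{n−1} (w−ζ)^{−(n+1)} dA(w)`. -/
def Kker (Ω : Set ℂ) (n : ℕ) (z ζ : ℂ) : ℂ :=
  ∫ w in Ωᶜ,
    ((z - w) ^ 2)⁻¹ * ((n : ℂ) * (starRingEnd ℂ) (w - ζ) ^ (n - 1) / (w - ζ) ^ (n + 1))

/-- The Hölder norm `‖g‖_{α,Ω} = sup_Ω |g| + σ_α(g)`, valued in `ℝ≥0∞`. -/
def holderNorm {X : Type*} [NormedAddCommGroup X] (α : ℝ) (Ω : Set X) (f : X → ℂ) : ℝ≥0∞ :=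
  (⨆ x : Ω, (‖f x.1‖₊ : ℝ≥0∞)) +
    ⨆ p : Ω × Ω, ENNReal.ofReal (‖f p.1.1 - f p.2.1‖ / ‖p.1.1 - p.2.1‖ ^ α)

/-- `x ^ (-s)` in `ℝ≥0∞`, equal to `⊤` for `x ≤ 0` and `s > 0`. -/
def pw (x s : ℝ) : ℝ≥0∞ := ((ENNReal.ofReal x)⁻¹) ^ s

theorem pw_anti {x y s : ℝ} (hs : 0 ≤ s) (h : x ≤ y) : pw y s ≤ pw x s := by
  unfold pw
  exact ENNReal.rpow_le_rpow (ENNReal.inv_le_inv.2 (ENNReal.ofReal_le_ofReal h)) hs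

theorem pw_add (x : ℝ) {s t : ℝ} (hs : 0 ≤ s) (ht : 0 ≤ t) : pw x (s + t) = pw x s * pw x t := by
  unfold pw
  exact ENNReal.rpow_add_of_nonneg s t hs ht

theorem pw_eq {x : ℝ} (hx : 0 < x) (s : ℝ) : pw x s = ENNReal.ofReal (x ^ (-s)) := by
  unfold pw
  rw [← ENNReal.ofReal_inv_of_pos hx, ENNReal.ofReal_rpow_of_pos (inv_pos.2 hx),
    Real.rpow_neg hx.le, Real.inv_rpow hx.le]

theorem pw_ne_top {x : ℝ} (hx : 0 < x) (s : ℝ) : pw x s ≠ ⊤ := by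
  rw [pw_eq hx]; exact ENNReal.ofReal_ne_top

theorem pw_top {x s : ℝ} (hx : x ≤ 0) (hs : 0 < s) : pw x s = ⊤ := by
  unfold pw
  rw [ENNReal.ofReal_of_nonpos hx, ENNReal.inv_zero, ENNReal.top_rpow_of_pos hs]

theorem pw_rpow (x s t : ℝ) : (pw x s) ^ t = pw x (s * t) := by
  unfold pw; rw [ENNReal.rpow_mul]

theorem pw_mul_left {c : ℝ} (hc : 0 < c) (x s : ℝ) (hs : 0 ≤ s) : pw (c * x) s = pw c s * pw x s := by
  unfold pw
  rw [← ENNReal.mul_rpow_of_nonneg _ _ hs, ENNReal.ofReal_mul hc.le, ENNReal.mul_inv]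
  · left; simpa using hc
  · left; simp

@[fun_prop]
theorem measurable_pw (s : ℝ) : Measurable (fun x => pw x s) := by
  unfold pw
  fun_prop

theorem pw_le_one {x s : ℝ} (hs : 0 ≤ s) (hx : 1 ≤ x) : pw x s ≤ 1 := by
  refine (pw_anti hs hx).trans ?_
  simp [pw]

/-- one-dimensional integral -/
theorem lint1 (s D : ℝ) (hs0 : 0 ≤ s) (hs : s < 1) : ∫⁻ x in Icc (-D) D, pw |x| s < ⊤ := by
  have h1 : IntegrableOn (fun x : ℝ => |x| ^ (-s)) (Icc (-D) D) := by
    have h0 : IntegrableOn (fun x : ℝ => |x| ^ (-s)) (Ioc 0 D) := by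
      have : IntegrableOn (fun x : ℝ => x ^ (-s)) (Ioc 0 D) := by
        rcases le_or_gt 0 D with h | h
        · exact (intervalIntegrable_iff_integrableOn_Ioc_of_le h).1
            (intervalIntegral.intervalIntegrable_rpow' (by linarith))
        · rw [Ioc_eq_empty (by linarith)]; simp
      refine this.congr_fun ?_ measurableSet_Ioc
      intro x hx
      simp only [abs_of_pos hx.1]
    have h2 : IntegrableOn (fun x : ℝ => |x| ^ (-s)) (Ico (-D) 0) := by
      have := (Measure.measurePreserving_neg (volume : Measure ℝ)).integrableOn_comp_preimage
        (f := fun x : ℝ => |x| ^ (-s)) (s := Ioc 0 D) (Homeomorph.neg ℝ).measurableEmbedding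
      have h3 := this.2 h0
      have e : (fun x : ℝ => |x| ^ (-s)) ∘ Neg.neg = (fun x : ℝ => |x| ^ (-s)) := by
        ext x; simp
      rw [e] at h3
      convert h3 using 1
      ext x; simp only [mem_Ico, mem_preimage, mem_Ioc]; constructor <;> rintro ⟨a, b⟩ <;> constructor <;> linarith
    have h3 : IntegrableOn (fun x : ℝ => |x| ^ (-s)) {(0:ℝ)} := by
      simp
    refine ((h2.union h3).union h0).mono_set ?_
    intro x hx
    rcases lt_trichotomy x 0 with h | h | h
    · left; left; exact ⟨hx.1, h⟩
    · left; right; exact h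
    · right; exact ⟨h, hx.2⟩
  have h2 : ∫⁻ x in Icc (-D) D, pw |x| s = ∫⁻ x in Icc (-D) D, ENNReal.ofReal (|x| ^ (-s)) := by
    apply lintegral_congr_ae
    apply ae_restrict_of_ae
    have : ∀ᵐ x : ℝ, x ≠ 0 := by
      simp [ae_iff]
    filter_upwards [this] with x hx
    exact pw_eq (abs_pos.2 hx) s
  rw [h2]
  exact h1.lintegral_lt_top

/-- change of variables to orthonormal coordinates -/
theorem lint_rot (e a : ℂ) (he : ‖e‖ = 1) (f : ℂ → ℝ≥0∞) :
    ∫⁻ w, f (e * (w - a)) = ∫⁻ w, f w := by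
  have h1 : ∫⁻ w, f (e * (w - a)) = ∫⁻ w, f (e * w) :=
    lintegral_sub_right_eq_self (fun w => f (e * w)) a
  rw [h1]
  have hu : e ∈ Submonoid.unitSphere ℂ := by simp [Submonoid.unitSphere, he]
  let c : Circle := ⟨e, hu⟩
  have := (rotation c).measurePreserving.lintegral_comp_emb
    (rotation c).toHomeomorph.measurableEmbedding f
  exact this

theorem lint_prod (f : ℂ → ℝ≥0∞) (hf : Measurable f) :
    ∫⁻ w, f w = ∫⁻ x : ℝ, ∫⁻ y : ℝ, f ⟨x, y⟩ := by
  have h := (Complex.volume_preserving_equiv_real_prod.symm).lintegral_comp_emb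
    (Complex.measurableEquivRealProd.symm.measurableEmbedding) f
  rw [← h]
  rw [Measure.volume_eq_prod, lintegral_prod]
  · rfl
  · exact (hf.comp Complex.measurableEquivRealProd.symm.measurable).aemeasurable

/-- integral over a rotated ball of a product of powers -/
theorem lint_box (s t D : ℝ) (hs0 : 0 ≤ s) (hs : s < 1) (ht0 : 0 ≤ t) (ht : t < 1) :
    ∃ C : ℝ≥0∞, C < ⊤ ∧ ∀ e a : ℂ, ‖e‖ = 1 →
      ∫⁻ w in closedBall a D, pw |(e * (w - a)).re| s * pw |(e * (w - a)).im| t ≤ C := by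
  refine ⟨(∫⁻ x in Icc (-D) D, pw |x| s) * ∫⁻ x in Icc (-D) D, pw |x| t,
    ENNReal.mul_lt_top (lint1 s D hs0 hs) (lint1 t D ht0 ht), ?_⟩
  intro e a he
  set g : ℂ → ℝ≥0∞ := fun u => (Icc (-D) D).indicator (fun x => pw |x| s) u.re *
    (Icc (-D) D).indicator (fun x => pw |x| t) u.im with hg
  have hgm : Measurable g := by
    have h1 : Measurable ((Icc (-D) D).indicator (fun x : ℝ => pw |x| s)) :=
      Measurable.indicator (by fun_prop) measurableSet_Icc
    have h2 : Measurable ((Icc (-D) D).indicator (fun x : ℝ => pw |x| t)) :=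
      Measurable.indicator (by fun_prop) measurableSet_Icc
    exact (h1.comp Complex.measurable_re).mul (h2.comp Complex.measurable_im)
  calc ∫⁻ w in closedBall a D, pw |(e * (w - a)).re| s * pw |(e * (w - a)).im| t
      ≤ ∫⁻ w in closedBall a D, g (e * (w - a)) := by
        apply setLIntegral_mono' measurableSet_closedBall
        intro w hw
        have hn : ‖e * (w - a)‖ ≤ D := by
          rw [norm_mul, he, one_mul, ← dist_eq_norm]; exact hw
        have h1 : (e * (w - a)).re ∈ Icc (-D) D :=
          abs_le.1 ((Complex.abs_re_le_norm _).trans hn)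
        have h2 : (e * (w - a)).im ∈ Icc (-D) D :=
          abs_le.1 ((Complex.abs_im_le_norm _).trans hn)
        simp only [hg, indicator_of_mem h1, indicator_of_mem h2]
        exact le_rfl
    _ ≤ ∫⁻ w, g (e * (w - a)) := setLIntegral_le_lintegral _ _
    _ = ∫⁻ w, g w := lint_rot e a he g
    _ = ∫⁻ x : ℝ, ∫⁻ y : ℝ, g ⟨x, y⟩ := lint_prod g hgm
    _ = _ := by
        simp only [hg]
        rw [lintegral_lintegral_mul]
        · rw [lintegral_indicator measurableSet_Icc, lintegral_indicator measurableSet_Icc]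
        · exact (Measurable.indicator (by fun_prop) measurableSet_Icc).aemeasurable
        · exact (Measurable.indicator (by fun_prop) measurableSet_Icc).aemeasurable

/-- Riesz kernel on balls -/
theorem lint_riesz (s D : ℝ) (hs0 : 0 ≤ s) (hs : s < 2) :
    ∃ C : ℝ≥0∞, C < ⊤ ∧ ∀ a : ℂ, ∫⁻ w in closedBall a D, pw ‖w - a‖ s ≤ C := by
  obtain ⟨C, hC, h⟩ := lint_box (s/2) (s/2) D (by linarith) (by linarith) (by linarith) (by linarith)
  refine ⟨C, hC, fun a => le_trans ?_ (h 1 a (by simp))⟩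
  apply lintegral_mono
  intro w
  simp only [one_mul]
  have : s = s/2 + s/2 := by ring
  conv_lhs => rw [this]
  rw [pw_add _ (by linarith) (by linarith)]
  gcongr
  · exact pw_anti (by linarith) (Complex.abs_re_le_norm _)
  · exact pw_anti (by linarith) (Complex.abs_im_le_norm _)

theorem lint_riesz_set (s : ℝ) (hs0 : 0 ≤ s) (hs : s < 2) (Ω : Set ℂ) (hΩ : volume Ω < ⊤) :
    ∃ C : ℝ≥0∞, C < ⊤ ∧ ∀ a : ℂ, ∫⁻ w in Ω, pw ‖w - a‖ s ≤ C := by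
  obtain ⟨C, hC, h⟩ := lint_riesz s 1 hs0 hs
  refine ⟨C + volume Ω, ENNReal.add_lt_top.2 ⟨hC, hΩ⟩, fun a => ?_⟩
  calc ∫⁻ w in Ω, pw ‖w - a‖ s ≤ ∫⁻ w in Ω, ((closedBall a 1).indicator (fun w => pw ‖w - a‖ s) w + 1) := by
        apply lintegral_mono
        intro w
        by_cases hw : w ∈ closedBall a 1
        · simp [hw]
        · simp only [indicator_of_notMem hw, zero_add]
          apply pw_le_one hs0
          rw [mem_closedBall, dist_eq_norm] at hw
          linarith
    _ = (∫⁻ w in Ω, (closedBall a 1).indicator (fun w => pw ‖w - a‖ s) w) + volume Ω := by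
        rw [lintegral_add_right _ measurable_const]; simp
    _ ≤ (∫⁻ w, (closedBall a 1).indicator (fun w => pw ‖w - a‖ s) w) + volume Ω := by
        gcongr; exact Measure.restrict_le_self
    _ ≤ _ := by
        rw [lintegral_indicator measurableSet_closedBall]
        gcongr; exact h a

/-- tails -/
theorem lint_tail (s r : ℝ) (hs : 2 < s) (hr : 0 < r) :
    ∃ C : ℝ≥0∞, C < ⊤ ∧ ∀ a : ℂ, ∫⁻ w in {w | r ≤ ‖w - a‖}, pw ‖w - a‖ s ≤ C := by
  have hI : Integrable (fun x : ℂ => (1 + ‖x‖) ^ (-s)) := by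
    apply integrable_one_add_norm
    simp; exact hs
  set c := (r / (1 + r)) with hc
  have hcp : 0 < c := by positivity
  refine ⟨pw c s * ∫⁻ x : ℂ, ENNReal.ofReal ((1 + ‖x‖) ^ (-s)), ?_, ?_⟩
  · exact ENNReal.mul_lt_top (pw_ne_top hcp s).lt_top hI.lintegral_lt_top
  intro a
  have h1 : ∫⁻ x : ℂ, ENNReal.ofReal ((1 + ‖x‖) ^ (-s)) =
      ∫⁻ x : ℂ, pw (1 + ‖x - a‖) s := by
    rw [← lintegral_sub_right_eq_self _ a]
    apply lintegral_congr
    intro x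
    rw [pw_eq (by positivity)]
  rw [h1, ← lintegral_const_mul _ (by fun_prop)]
  refine le_trans ?_ (setLIntegral_le_lintegral {w | r ≤ ‖w - a‖} _)
  apply setLIntegral_mono (by fun_prop)
  intro w hw
  rw [← pw_mul_left hcp _ _ (by linarith)]
  apply pw_anti (by linarith)
  rw [hc, div_mul_eq_mul_div, div_le_iff₀ (by positivity)]
  have : r ≤ ‖w - a‖ := hw
  nlinarith



/-- the kernel of the iterated Beurling transform -/
def kk (n : ℕ) (u : ℂ) : ℂ := (n : ℂ) * (starRingEnd ℂ) u ^ (n - 1) / u ^ (n + 1)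

theorem norm_kk (n : ℕ) (hn : 1 ≤ n) (u : ℂ) : ‖kk n u‖ = n / ‖u‖ ^ 2 := by
  unfold kk
  rw [norm_div, norm_mul, norm_pow, norm_pow, RCLike.norm_conj, Complex.norm_natCast]
  rcases eq_or_ne u 0 with h | h
  · simp [h]
  have h' : ‖u‖ ≠ 0 := by simpa using h
  obtain ⟨m, rfl⟩ : ∃ m, n = m + 1 := ⟨n - 1, by omega⟩
  rw [div_eq_div_iff (by positivity) (by positivity)]
  simp only [Nat.add_sub_cancel]
  ring

@[fun_prop]
theorem measurable_kk (n : ℕ) : Measurable (kk n) := by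
  unfold kk
  have : Measurable (starRingEnd ℂ) := Complex.continuous_conj.measurable
  fun_prop

theorem line_zero (f : ℂ → ℂ) (C : ℝ) (hd : DifferentiableOn ℂ f {w | 0 ≤ w.im})
    (hb : ∀ w : ℂ, 0 ≤ w.im → ‖f w‖ ≤ C / (1 + ‖w‖) ^ 2) : ∫ x : ℝ, f x = 0 := by
  have hC : 0 ≤ C := by
    have := (norm_nonneg _).trans (hb 0 (by simp))
    simpa using this
  have hintg : Integrable (fun x : ℝ => f x) := by
    have h1 : Integrable (fun x : ℝ => C * (1 + ‖x‖) ^ (-2 : ℝ)) :=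
      (integrable_one_add_norm (by simp)).const_mul C
    refine h1.mono' ?_ ?_
    · apply Continuous.aestronglyMeasurable
      exact hd.continuousOn.comp_continuous Complex.continuous_ofReal (fun x => by simp)
    · filter_upwards with x
      refine (hb x (by simp)).trans (le_of_eq ?_)
      rw [Real.rpow_neg (by positivity), div_eq_mul_inv, Complex.norm_real]
      norm_cast
  have ht : Tendsto (fun R : ℝ => ∫ x in (-R)..R, f x) atTop (𝓝 (∫ x : ℝ, f x)) :=
    intervalIntegral_tendsto_integral hintg tendsto_neg_atTop_atBot tendsto_id
  have h0 : Tendsto (fun R : ℝ => ∫ x in (-R)..R, f x) atTop (𝓝 0) := by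
    apply squeeze_zero_norm' (a := fun R : ℝ => 4 * C / R)
    · filter_upwards [eventually_gt_atTop 0] with R hR
      have hrect := Complex.integral_boundary_rect_eq_zero_of_differentiableOn f (-R : ℂ) (R + R * I)
        (hd.mono (by
          intro w hw
          rw [mem_reProdIm] at hw
          have := hw.2
          simp [uIcc_of_le hR.le] at this
          exact this.1))
      simp at hrect
      have key : ∀ w : ℂ, 0 ≤ w.im → R ≤ ‖w‖ → ‖f w‖ ≤ C / R ^ 2 := by
        intro w hw hRw
        refine (hb w hw).trans ?_
        gcongr; linarith
      have b1 : ‖∫ x in (-R)..R, f (x + R * I)‖ ≤ C / R ^ 2 * |R - -R| := by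
        apply intervalIntegral.norm_integral_le_of_norm_le_const
        intro x hx
        apply key
        · simp [hR.le]
        · have := Complex.abs_im_le_norm (x + R * I)
          simp [abs_of_pos hR] at this; exact this
      have b2 : ‖∫ y in (0:ℝ)..R, f (R + y * I)‖ ≤ C / R ^ 2 * |R - 0| := by
        apply intervalIntegral.norm_integral_le_of_norm_le_const
        intro x hx
        rw [uIoc_of_le hR.le] at hx
        apply key
        · simp [hx.1.le]
        · have := Complex.abs_re_le_norm (R + x * I)
          simp [abs_of_pos hR] at this; exact this
      have b3 : ‖∫ y in (0:ℝ)..R, f (-R + y * I)‖ ≤ C / R ^ 2 * |R - 0| := by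
        apply intervalIntegral.norm_integral_le_of_norm_le_const
        intro x hx
        rw [uIoc_of_le hR.le] at hx
        apply key
        · simp [hx.1.le]
        · have := Complex.abs_re_le_norm (-R + x * I)
          simp [abs_of_pos hR] at this; exact this
      have e : ∫ x in (-R)..R, f x = (∫ x in (-R)..R, f (x + R * I))
          - I * (∫ y in (0:ℝ)..R, f (R + y * I)) + I * ∫ y in (0:ℝ)..R, f (-R + y * I) := by
        linear_combination hrect
      rw [e]
      refine (norm_add_le _ _).trans ?_
      have := norm_sub_le (∫ x in (-R)..R, f (x + R * I)) (I * (∫ y in (0:ℝ)..R, f (R + y * I)))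
      rw [norm_mul, Complex.norm_I, one_mul] at this
      rw [norm_mul, Complex.norm_I, one_mul]
      rw [abs_of_pos (by linarith)] at b1 b2 b3
      have e2 : C / R ^ 2 * (R - -R) + C / R ^ 2 * (R - 0) + C / R ^ 2 * (R - 0) = 4 * C / R := by
        field_simp; ring
      linarith
    · exact tendsto_const_nhds.div_atTop tendsto_id
  exact tendsto_nhds_unique ht h0

theorem low_bound {m : ℝ} (hm : 0 < m) (P w : ℂ) (h : m ≤ ‖w - P‖) :
    m / (1 + ‖P‖ + m) * (1 + ‖w‖) ≤ ‖w - P‖ := by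
  rw [div_mul_eq_mul_div, div_le_iff₀ (by positivity)]
  have : ‖w‖ ≤ ‖w - P‖ + ‖P‖ := by
    simpa using norm_add_le (w - P) P
  nlinarith [norm_nonneg P]

theorem integrableOn_kernel (n : ℕ) (hn : 1 ≤ n) (S : Set ℂ) (hS : MeasurableSet S) (z ζ : ℂ) (m : ℝ)
    (hm : 0 < m) (h1 : ∀ w ∈ S, m ≤ ‖w - z‖) (h2 : ∀ w ∈ S, m ≤ ‖w - ζ‖) :
    IntegrableOn (fun w => ((z - w) ^ 2)⁻¹ * kk n (w - ζ)) S := by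
  set c := m / (1 + ‖z‖ + m)
  set c' := m / (1 + ‖ζ‖ + m)
  have hc : 0 < c := by positivity
  have hc' : 0 < c' := by positivity
  have hI : Integrable (fun w : ℂ => (n / (c ^ 2 * c' ^ 2)) * (1 + ‖w‖) ^ (-4 : ℝ)) :=
    (integrable_one_add_norm (by simp; norm_num)).const_mul _
  refine Integrable.mono' hI.integrableOn ?_ ?_
  · apply Measurable.aestronglyMeasurable
    fun_prop
  · filter_upwards [ae_restrict_mem hS] with w hw
    have a1 := low_bound hm z w (h1 w hw)
    have a2 := low_bound hm ζ w (h2 w hw)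
    rw [norm_mul, norm_kk n hn, norm_inv, norm_pow, norm_sub_rev z w]
    rw [Real.rpow_neg (by positivity)]
    have : ((1 + ‖w‖) ^ (4:ℝ)) = (1 + ‖w‖) ^ 2 * (1 + ‖w‖) ^ 2 := by
      norm_cast; ring
    rw [this]
    have p : 0 < 1 + ‖w‖ := by positivity
    calc (‖w - z‖ ^ 2)⁻¹ * (n / ‖w - ζ‖ ^ 2) ≤ ((c * (1 + ‖w‖)) ^ 2)⁻¹ * (n / (c' * (1 + ‖w‖)) ^ 2) := by
          gcongr
      _ = _ := by field_simp

theorem line_kernel (n : ℕ) (hn : 1 ≤ n) (p q : ℂ) (hp : p.im < 0) (hq : q.im < 0) (y : ℝ) (hy : 0 < y) :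
    ∫ x : ℝ, ((p - (⟨x, y⟩ : ℂ)) ^ 2)⁻¹ * kk n ((⟨x, y⟩ : ℂ) - q) = 0 := by
  have key := line_zero (fun w => ((p - (w + y * I)) ^ 2)⁻¹ *
    ((n : ℂ) * (w - y * I - (starRingEnd ℂ) q) ^ (n - 1) / (w + y * I - q) ^ (n + 1)))
    ((1 / (-p.im / (1 + ‖p - y * I‖ + -p.im)) ^ 2) * (n / q.im ^ 2)) ?_ ?_
  · rw [← key]
    apply integral_congr_ae
    filter_upwards with x
    have e : (⟨x, y⟩ : ℂ) = x + y * I := by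
      apply Complex.ext <;> simp
    rw [e]
    simp only [kk]
    congr 4
    simp
    ring
  · intro w hw
    have hw' : 0 ≤ w.im := hw
    apply DifferentiableAt.differentiableWithinAt
    have n1 : (p - (w + y * I)) ≠ 0 := by
      intro h
      have := congrArg Complex.im h
      simp at this; linarith
    have n2 : (w + y * I - q) ≠ 0 := by
      intro h
      have := congrArg Complex.im h
      simp at this; linarith
    have n1' := pow_ne_zero 2 n1
    have n2' := pow_ne_zero (n+1) n2
    fun_prop (disch := assumption)
  · intro w hw
    have q1 : -p.im ≤ ‖w - (p - y * I)‖ := by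
      have := Complex.abs_im_le_norm (w - (p - y * I))
      refine le_trans ?_ this
      simp
      refine le_trans ?_ (le_abs_self _)
      linarith
    have q1' := low_bound (by linarith) _ _ q1
    have q2 : -q.im ≤ ‖w + y * I - q‖ := by
      have := Complex.abs_im_le_norm (w + y * I - q)
      refine le_trans ?_ this
      simp
      refine le_trans ?_ (le_abs_self _)
      linarith
    have q3 : ‖w - y * I - (starRingEnd ℂ) q‖ ≤ ‖w + y * I - q‖ := by
      rw [Complex.norm_def, Complex.norm_def]
      apply Real.sqrt_le_sqrt
      simp [Complex.normSq_apply]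
      nlinarith
    have hpos : 0 < ‖w + y * I - q‖ := by linarith
    have e1 : ‖p - (w + y * I)‖ = ‖w - (p - y * I)‖ := by
      rw [← norm_neg]; congr 1; ring
    rw [norm_mul, norm_inv, norm_pow, norm_div, norm_mul, norm_pow, norm_pow, Complex.norm_natCast, e1]
    set c := -p.im / (1 + ‖p - y * I‖ + -p.im) with hc
    have hcp : 0 < c := by
      have : 0 < -p.im := by linarith
      positivity
    have f1 : (‖w - (p - y * I)‖ ^ 2)⁻¹ ≤ ((c * (1 + ‖w‖)) ^ 2)⁻¹ := by
      gcongr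
    have f2 : n * ‖w - y * I - (starRingEnd ℂ) q‖ ^ (n - 1) / ‖w + y * I - q‖ ^ (n + 1)
        ≤ n / q.im ^ 2 := by
      obtain ⟨m, rfl⟩ : ∃ m, n = m + 1 := ⟨n - 1, by omega⟩
      simp only [Nat.add_sub_cancel]
      calc (↑(m + 1)) * ‖w - y * I - (starRingEnd ℂ) q‖ ^ m / ‖w + y * I - q‖ ^ (m + 1 + 1)
          ≤ (↑(m + 1)) * ‖w + y * I - q‖ ^ m / ‖w + y * I - q‖ ^ (m + 1 + 1) := by gcongr
        _ = (↑(m + 1)) / ‖w + y * I - q‖ ^ 2 := by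
            field_simp
            ring
        _ ≤ (↑(m + 1)) / q.im ^ 2 := by
            have : 0 < q.im ^ 2 := by nlinarith
            have h2 : q.im ^ 2 ≤ ‖w + y * I - q‖ ^ 2 := by nlinarith
            exact div_le_div_of_nonneg_left (by positivity) this h2
    calc _ ≤ ((c * (1 + ‖w‖)) ^ 2)⁻¹ * (n / q.im ^ 2) := by gcongr
      _ = _ := by
        rw [mul_pow, mul_inv]; ring

theorem half_zero_flat (n : ℕ) (hn : 1 ≤ n) (p q : ℂ) (hp : p.im < 0) (hq : q.im < 0) :
    ∫ w in {w : ℂ | 0 < w.im}, ((p - w) ^ 2)⁻¹ * kk n (w - q) = 0 := by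
  have hS : MeasurableSet {w : ℂ | 0 < w.im} := measurableSet_lt measurable_const Complex.measurable_im
  have hI : IntegrableOn (fun w => ((p - w) ^ 2)⁻¹ * kk n (w - q)) {w : ℂ | 0 < w.im} := by
    have hlow : ∀ P : ℂ, P.im < 0 → ∀ w : ℂ, 0 < w.im → -P.im ≤ ‖w - P‖ := by
      intro P hP w hw
      have := (le_abs_self _).trans (Complex.abs_im_le_norm (w - P))
      simp at this
      linarith
    apply integrableOn_kernel n hn _ hS _ _ (min (-p.im) (-q.im)) (by simp [hp, hq])
    · intro w hw; exact (min_le_left _ _).trans (hlow p hp w hw)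
    · intro w hw; exact (min_le_right _ _).trans (hlow q hq w hw)
  rw [← integral_indicator hS]
  rw [← integrable_indicator_iff hS] at hI
  set G := indicator {w : ℂ | 0 < w.im} (fun w => ((p - w) ^ 2)⁻¹ * kk n (w - q)) with hG
  have hmp := Complex.volume_preserving_equiv_real_prod.symm
  have hemb := Complex.measurableEquivRealProd.symm.measurableEmbedding
  rw [← hmp.integral_comp hemb]
  have hI2 := (hmp.integrable_comp_emb hemb).2 hI
  rw [Measure.volume_eq_prod] at hI2 ⊢
  refine (integral_prod_symm _ hI2).trans ?_
  apply integral_eq_zero_of_ae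
  filter_upwards with y
  simp only [Pi.zero_apply]
  rcases le_or_gt y 0 with hy | hy
  · apply integral_eq_zero_of_ae
    filter_upwards with x
    simp only [hG]
    apply indicator_of_notMem
    simp [Complex.measurableEquivRealProd]
    exact hy
  · rw [← line_kernel n hn p q hp hq y hy]
    apply integral_congr_ae
    filter_upwards with x
    simp only [hG]
    exact indicator_of_mem (by simp [Complex.measurableEquivRealProd]; exact hy) _

theorem kk_mul (n : ℕ) (e u : ℂ) (he : ‖e‖ = 1) :
    kk n (e * u) = (kk n e / n) * kk n u := by
  unfold kk
  have : e ≠ 0 := by intro h; simp [h] at he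
  rcases Nat.eq_zero_or_pos n with h | h
  · simp [h]
  have : (n : ℂ) ≠ 0 := by exact_mod_cast h.ne'
  rw [map_mul, mul_pow, mul_pow]
  field_simp

/-- vanishing over a general half plane -/
theorem half_zero (n : ℕ) (hn : 1 ≤ n) (e a p q : ℂ) (he : ‖e‖ = 1) (hp : (e * (p - a)).im < 0)
    (hq : (e * (q - a)).im < 0) :
    ∫ w in {w : ℂ | 0 < (e * (w - a)).im}, ((p - w) ^ 2)⁻¹ * kk n (w - q) = 0 := by
  have he0 : e ≠ 0 := by intro h; simp [h] at he
  have h0 := half_zero_flat n hn _ _ hp hq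
  have hS : MeasurableSet {w : ℂ | 0 < w.im} := measurableSet_lt measurable_const Complex.measurable_im
  have hS' : MeasurableSet {w : ℂ | 0 < (e * (w - a)).im} :=
    measurableSet_lt measurable_const (by fun_prop)
  rw [← integral_indicator hS] at h0
  rw [← integral_indicator hS']
  set G := indicator {w : ℂ | 0 < w.im} (fun w => ((e * (p - a) - w) ^ 2)⁻¹ * kk n (w - e * (q - a))) with hG
  have hu : e ∈ Submonoid.unitSphere ℂ := by simp [Submonoid.unitSphere, he]
  let c : Circle := ⟨e, hu⟩
  have h1 := (rotation c).measurePreserving.integral_comp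
    (rotation c).toHomeomorph.measurableEmbedding G
  have h2 : ∫ w, G (e * (w - a)) = 0 := by
    rw [integral_sub_right_eq_self (fun w => G (e * w)) a]
    rw [← h0]
    exact h1
  have hkn : kk n e / n ≠ 0 := by
    have : (n : ℂ) ≠ 0 := by exact_mod_cast (by omega : n ≠ 0)
    apply div_ne_zero _ this
    rw [← norm_ne_zero_iff, norm_kk n hn, he]
    simp; omega
  have h3 : ∀ w, G (e * (w - a)) = ((e ^ 2)⁻¹ * (kk n e / n)) *
      indicator {w : ℂ | 0 < (e * (w - a)).im} (fun w => ((p - w) ^ 2)⁻¹ * kk n (w - q)) w := by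
    intro w
    by_cases hw : 0 < (e * (w - a)).im
    · rw [hG, indicator_of_mem (by exact hw), indicator_of_mem (by exact hw)]
      have e1 : e * (p - a) - e * (w - a) = e * (p - w) := by ring
      have e2 : e * (w - a) - e * (q - a) = e * (w - q) := by ring
      rw [e1, e2, kk_mul n e _ he, mul_pow, mul_inv]
      ring
    · rw [hG, indicator_of_notMem (by exact hw), indicator_of_notMem (by exact hw), mul_zero]
  simp_rw [h3] at h2
  rw [integral_const_mul] at h2
  rcases mul_eq_zero.1 h2 with h | h
  · exfalso
    rcases mul_eq_zero.1 h with h | h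
    · exact (inv_ne_zero (pow_ne_zero 2 he0)) h
    · exact hkn h
  · exact h



theorem inv_sq_diff {m : ℝ} (hm : 0 < m) (u v : ℂ) (hu : m ≤ ‖u‖) (hv : m ≤ ‖v‖) :
    ‖(u ^ 2)⁻¹ - (v ^ 2)⁻¹‖ ≤ 2 * ‖u - v‖ / m ^ 3 := by
  have pu : 0 < ‖u‖ := by linarith
  have pv : 0 < ‖v‖ := by linarith
  have u0 : u ≠ 0 := norm_pos_iff.1 pu
  have v0 : v ≠ 0 := norm_pos_iff.1 pv
  have e : (u ^ 2)⁻¹ - (v ^ 2)⁻¹ = (v - u) * (u⁻¹ * (v⁻¹) ^ 2 + (u⁻¹) ^ 2 * v⁻¹) := by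
    field_simp; ring
  rw [e, norm_mul, norm_sub_rev v u]
  have h1 : ‖u⁻¹‖ ≤ m⁻¹ := by rw [norm_inv]; gcongr
  have h2 : ‖v⁻¹‖ ≤ m⁻¹ := by rw [norm_inv]; gcongr
  have h3 : ‖u⁻¹ * (v⁻¹) ^ 2 + (u⁻¹) ^ 2 * v⁻¹‖ ≤ m⁻¹ * m⁻¹ ^ 2 + m⁻¹ ^ 2 * m⁻¹ := by
    refine (norm_add_le _ _).trans ?_
    rw [norm_mul, norm_mul, norm_pow, norm_pow]
    gcongr
  calc ‖u - v‖ * ‖u⁻¹ * (v⁻¹) ^ 2 + (u⁻¹) ^ 2 * v⁻¹‖ ≤ ‖u - v‖ * (m⁻¹ * m⁻¹ ^ 2 + m⁻¹ ^ 2 * m⁻¹) := by gcongr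
    _ = _ := by field_simp; ring

theorem unit_pow_diff (a b : ℂ) (ha : ‖a‖ = 1) (hb : ‖b‖ = 1) (k : ℕ) :
    ‖a ^ k - b ^ k‖ ≤ k * ‖a - b‖ := by
  induction k with
  | zero => simp
  | succ k ih =>
    have : a ^ (k+1) - b ^ (k+1) = a * (a ^ k - b ^ k) + (a - b) * b ^ k := by ring
    rw [this]
    refine (norm_add_le _ _).trans ?_
    rw [norm_mul, norm_mul, norm_pow, ha, hb]
    push_cast
    simp only [one_pow]
    linarith

theorem kk_diff (n : ℕ) {m : ℝ} (hm : 0 < m) (u v : ℂ) (hu : m ≤ ‖u‖) (hv : m ≤ ‖v‖) :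
    ‖kk n u - kk n v‖ ≤ (2 * n * (n + 1)) * ‖u - v‖ / m ^ 3 := by
  have pu : 0 < ‖u‖ := by linarith
  have pv : 0 < ‖v‖ := by linarith
  have u0 : u ≠ 0 := norm_pos_iff.1 pu
  have v0 : v ≠ 0 := norm_pos_iff.1 pv
  rcases Nat.eq_zero_or_pos n with h | h
  · simp [h, kk]
  obtain ⟨k, rfl⟩ : ∃ k, n = k + 1 := ⟨n - 1, by omega⟩
  have e : ∀ u : ℂ, u ≠ 0 → kk (k+1) u = (k + 1) * (((starRingEnd ℂ) u / u) ^ k * (u ^ 2)⁻¹) := by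
    intro u hu
    simp only [kk, Nat.add_sub_cancel, div_pow]
    push_cast
    field_simp
    ring
  set A := (starRingEnd ℂ) u / u
  set B := (starRingEnd ℂ) v / v
  have hA : ‖A‖ = 1 := by simp [A, pu.ne']
  have hB : ‖B‖ = 1 := by simp [B, pv.ne']
  have hAB : ‖A - B‖ ≤ 2 * ‖u - v‖ / m := by
    have : A - B = ((starRingEnd ℂ) u / u) * ((v - u) / v) + ((starRingEnd ℂ) (u - v)) / v := by
      simp only [A, B, map_sub]; field_simp; ring
    rw [this]
    refine (norm_add_le _ _).trans ?_
    rw [norm_mul, hA, norm_div, norm_div, RCLike.norm_conj, norm_sub_rev v u]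
    have : ‖u - v‖ / ‖v‖ ≤ ‖u - v‖ / m := by gcongr
    calc _ ≤ ‖u - v‖ / m + ‖u - v‖ / m := by linarith
      _ = _ := by ring
  rw [e u u0, e v v0, ← mul_sub]
  have : A ^ k * (u ^ 2)⁻¹ - B ^ k * (v ^ 2)⁻¹ = (A ^ k - B ^ k) * (u ^ 2)⁻¹ + B ^ k * ((u ^ 2)⁻¹ - (v ^ 2)⁻¹) := by
    ring
  rw [this, norm_mul]
  have h1 : ‖((u ^ 2)⁻¹ : ℂ)‖ ≤ (m ^ 2)⁻¹ := by rw [norm_inv, norm_pow]; gcongr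
  have h2 := inv_sq_diff hm u v hu hv
  have h3 := unit_pow_diff A B hA hB k
  have h4 : ‖((k : ℂ) + 1)‖ = (k : ℝ) + 1 := by
    have := Complex.norm_natCast (k+1)
    push_cast at this; exact this
  rw [h4]
  have h5 : ‖(A ^ k - B ^ k) * (u ^ 2)⁻¹ + B ^ k * ((u ^ 2)⁻¹ - (v ^ 2)⁻¹)‖ ≤
      (k * (2 * ‖u - v‖ / m)) * (m ^ 2)⁻¹ + 2 * ‖u - v‖ / m ^ 3 := by
    refine (norm_add_le _ _).trans ?_
    rw [norm_mul, norm_mul, norm_pow, hB, one_pow, one_mul]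
    gcongr
    exact h3.trans (by gcongr)
  calc _ ≤ ((k : ℝ) + 1) * ((k * (2 * ‖u - v‖ / m)) * (m ^ 2)⁻¹ + 2 * ‖u - v‖ / m ^ 3) := by gcongr
    _ = (2 * (k + 1) * (k + 1)) * ‖u - v‖ / m ^ 3 := by field_simp
    _ ≤ _ := by push_cast; gcongr; linarith

/-- reflection across the line `im (e (w - a)) = 0` -/
def reflPt (e a ζ : ℂ) : ℂ := a + (starRingEnd ℂ) e * (starRingEnd ℂ) (e * (ζ - a))

theorem conj_unit {e : ℂ} (he : ‖e‖ = 1) : e * (starRingEnd ℂ) e = 1 := by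
  rw [Complex.mul_conj, Complex.normSq_eq_norm_sq, he]; simp

theorem refl_eq {e : ℂ} (he : ‖e‖ = 1) (a ζ : ℂ) : e * (reflPt e a ζ - a) = (starRingEnd ℂ) (e * (ζ - a)) := by
  unfold reflPt
  rw [add_sub_cancel_left, ← mul_assoc, conj_unit he, one_mul]

theorem refl_norm {e : ℂ} (he : ‖e‖ = 1) (a ζ : ℂ) : ‖reflPt e a ζ - a‖ = ‖ζ - a‖ := by
  have := congrArg norm (refl_eq he a ζ)
  rw [RCLike.norm_conj, norm_mul, norm_mul, he, one_mul, one_mul] at this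
  exact this

theorem refl_far {e : ℂ} (he : ‖e‖ = 1) (a ζ w : ℂ) (h1 : 0 ≤ (e * (w - a)).im) (h2 : 0 ≤ (e * (ζ - a)).im) :
    ‖w - ζ‖ ≤ ‖w - reflPt e a ζ‖ := by
  have e1 : ‖w - ζ‖ = ‖e * (w - a) - e * (ζ - a)‖ := by
    rw [← mul_sub, norm_mul, he, one_mul]; congr 1; ring
  have e2 : ‖w - reflPt e a ζ‖ = ‖e * (w - a) - (starRingEnd ℂ) (e * (ζ - a))‖ := by
    rw [← refl_eq he, ← mul_sub, norm_mul, he, one_mul]; congr 1; ring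
  rw [e1, e2, Complex.norm_def, Complex.norm_def]
  apply Real.sqrt_le_sqrt
  generalize e * (w - a) = W at *
  generalize e * (ζ - a) = Z at *
  simp only [Complex.normSq_apply, Complex.sub_re, Complex.sub_im, Complex.conj_re, Complex.conj_im]
  nlinarith [mul_nonneg h1 h2]

theorem im_sub_le {e : ℂ} (he : ‖e‖ = 1) (a p w : ℂ) (hp : (e * (p - a)).im ≤ 0) :
    (e * (w - a)).im ≤ ‖w - p‖ := by
  have h : ‖w - p‖ = ‖e * (w - a) - e * (p - a)‖ := by
    rw [← mul_sub, norm_mul, he, one_mul]; congr 1; ring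
  have := (le_abs_self _).trans (Complex.abs_im_le_norm (e * (w - a) - e * (p - a)))
  rw [h]
  rw [Complex.sub_im] at this
  linarith

open Classical in
/-- comparison kernel -/
def Gk (n : ℕ) (e a ζ w : ℂ) : ℂ :=
  if (e * (ζ - a)).im < 0 then kk n (w - ζ) else
    ((a - reflPt e a ζ) ^ 2 * kk n (a - ζ)) * kk 1 (w - reflPt e a ζ)

theorem kk_one (u : ℂ) : kk 1 u = (u ^ 2)⁻¹ := by simp [kk]

theorem Gk_coeff {n : ℕ} (hn : 1 ≤ n) {e : ℂ} (he : ‖e‖ = 1) (a ζ : ℂ) (h : ζ ≠ a) :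
    ‖(a - reflPt e a ζ) ^ 2 * kk n (a - ζ)‖ = n := by
  rw [norm_mul, norm_pow, norm_kk n hn, norm_sub_rev, refl_norm he, norm_sub_rev a ζ]
  have : ‖ζ - a‖ ≠ 0 := by simpa [sub_eq_zero] using h
  field_simp

theorem sq_enorm_bound {x y η : ℝ} (c : ℝ) (hc : 0 ≤ c) (hx : 0 < x) (hxy : y ≤ x) (u : ℝ) (hu : u ≤ x)
    (h0 : 0 ≤ η) (h2 : η ≤ 2) :
    ENNReal.ofReal (c / x ^ 2) ≤ ENNReal.ofReal c * (pw y η * pw u (2 - η)) := by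
  have : ENNReal.ofReal (c / x ^ 2) = ENNReal.ofReal c * pw x 2 := by
    rw [pw_eq hx, ← ENNReal.ofReal_mul hc, Real.rpow_neg hx.le, div_eq_mul_inv]
    norm_cast
  rw [this]
  gcongr
  have e : (2 : ℝ) = η + (2 - η) := by ring
  conv_lhs => rw [e]
  rw [pw_add _ h0 (by linarith)]
  gcongr
  · exact pw_anti h0 hxy
  · exact pw_anti (by linarith) hu

theorem kk_enorm {n : ℕ} (hn : 1 ≤ n) (u : ℂ) (hu : u ≠ 0) : ‖kk n u‖ₑ = n * pw ‖u‖ 2 := by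
  have hx : 0 < ‖u‖ := norm_pos_iff.2 hu
  rw [← ofReal_norm, norm_kk n hn, pw_eq hx, Real.rpow_neg hx.le, div_eq_mul_inv,
    ENNReal.ofReal_mul (by positivity), ENNReal.ofReal_natCast]
  norm_cast

theorem Gk_bound {n : ℕ} (hn : 1 ≤ n) {e : ℂ} (he : ‖e‖ = 1) (a ζ w : ℂ) (hζa : ζ ≠ a)
    (hw : 0 < (e * (w - a)).im) {η : ℝ} (h0 : 0 ≤ η) (h2 : η ≤ 2) :
    ‖Gk n e a ζ w‖ₑ ≤ n * (pw (e * (w - a)).im η * pw ‖w - ζ‖ (2 - η)) := by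
  rw [← ofReal_norm]
  unfold Gk
  split_ifs with h
  · rw [norm_kk n hn]
    have := im_sub_le he a ζ w h.le
    have := sq_enorm_bound (y := (e * (w - a)).im) (x := ‖w - ζ‖) n (by positivity) (by linarith) this
      ‖w - ζ‖ le_rfl h0 h2
    simpa using this
  · have hs : (e * (reflPt e a ζ - a)).im ≤ 0 := by
      rw [refl_eq he, Complex.conj_im]; linarith
    have h1 := im_sub_le he a _ w hs
    have h3 := refl_far he a ζ w hw.le (by linarith)
    rw [norm_mul, Gk_coeff hn he a ζ hζa, norm_kk 1 le_rfl]
    have := sq_enorm_bound (y := (e * (w - a)).im) (x := ‖w - reflPt e a ζ‖) n (by positivity) (by linarith) h1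
      ‖w - ζ‖ h3 h0 h2
    rw [← mul_div_assoc]
    simpa using this

theorem Gk_diff {n : ℕ} (hn : 1 ≤ n) {e : ℂ} (he : ‖e‖ = 1) (a ζ w : ℂ) (hζa : ζ ≠ a)
    (hw : 0 < (e * (w - a)).im) (hζ : 0 ≤ (e * (ζ - a)).im) (hne : w ≠ ζ) :
    ‖kk n (w - ζ) - Gk n e a ζ w‖ ≤ (200 * n * (n + 1)) * ‖w - a‖ / ‖ζ - a‖ / ‖w - ζ‖ ^ 2 := by
  have pz : 0 < ‖ζ - a‖ := norm_pos_iff.2 (sub_ne_zero.2 hζa)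
  have pw' : 0 < ‖w - ζ‖ := norm_pos_iff.2 (sub_ne_zero.2 hne)
  have hco := Gk_coeff hn he a ζ hζa
  have hfar := refl_far he a ζ w hw.le hζ
  have hn' : (1 : ℝ) ≤ n := by exact_mod_cast hn
  unfold Gk
  rw [if_neg (by linarith)]
  set S := reflPt e a ζ with hS
  set c := (a - S) ^ 2 * kk n (a - ζ) with hc
  rcases le_or_gt (‖ζ - a‖ / 2) ‖w - a‖ with hcase | hcase
  · have h1 : ‖kk n (w - ζ)‖ = n / ‖w - ζ‖ ^ 2 := norm_kk n hn _
    have h2 : ‖c * kk 1 (w - S)‖ ≤ n / ‖w - ζ‖ ^ 2 := by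
      rw [norm_mul, hco, norm_kk 1 le_rfl, ← mul_div_assoc]
      simp only [Nat.cast_one, mul_one]
      gcongr
    refine (norm_sub_le _ _).trans ?_
    rw [h1]
    calc n / ‖w - ζ‖ ^ 2 + ‖c * kk 1 (w - S)‖ ≤ (2 * n) / ‖w - ζ‖ ^ 2 := by
          have : (2 * (n:ℝ)) / ‖w - ζ‖ ^ 2 = n / ‖w - ζ‖ ^ 2 + n / ‖w - ζ‖ ^ 2 := by ring
          rw [this]; gcongr
      _ ≤ _ := by
          gcongr
          rw [le_div_iff₀ pz]
          have q1 : (2 * n : ℝ) * ‖ζ - a‖ ≤ (2 * n) * (2 * ‖w - a‖) := by gcongr; linarith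
          have q2 : (4 * n : ℝ) * ‖w - a‖ ≤ (200 * n * (n + 1)) * ‖w - a‖ := by
            gcongr ?_ * _
            nlinarith
          linarith
  · have hS1 : ‖S - a‖ = ‖ζ - a‖ := refl_norm he a ζ
    have m1 : ‖ζ - a‖ / 2 ≤ ‖w - ζ‖ := by
      have : ‖ζ - a‖ ≤ ‖w - ζ‖ + ‖w - a‖ := by
        have := norm_sub_le (w - a) (w - ζ)
        simpa [add_comm] using this
      linarith
    have m2 : ‖w - ζ‖ ≤ 2 * ‖ζ - a‖ := by
      have : ‖w - ζ‖ ≤ ‖w - a‖ + ‖ζ - a‖ := by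
        have := norm_sub_le (w - a) (ζ - a)
        simpa using this
      linarith
    have d1 := kk_diff n (m := ‖ζ - a‖ / 2) (by linarith) (w - ζ) (a - ζ) m1
      (by rw [norm_sub_rev a ζ]; linarith)
    have d2 := kk_diff 1 (m := ‖ζ - a‖ / 2) (by linarith) (a - S) (w - S)
      (by rw [norm_sub_rev a S, hS1]; linarith) (by linarith)
    have aS : a - S ≠ 0 := by
      rw [← norm_pos_iff, norm_sub_rev, hS1]; exact pz
    have eq : kk n (a - ζ) = c * kk 1 (a - S) := by
      rw [hc, kk_one]; field_simp
    have : kk n (w - ζ) - c * kk 1 (w - S) = (kk n (w - ζ) - kk n (a - ζ)) +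
        c * (kk 1 (a - S) - kk 1 (w - S)) := by
      rw [mul_sub, ← eq]; ring
    rw [this]
    refine (norm_add_le _ _).trans ?_
    rw [norm_mul, hco]
    have e1 : w - ζ - (a - ζ) = w - a := by ring
    have e2 : ‖a - S - (w - S)‖ = ‖w - a‖ := by rw [← norm_neg]; congr 1; ring
    rw [e1] at d1
    rw [e2] at d2
    calc _ ≤ (2 * n * (n + 1)) * ‖w - a‖ / (‖ζ - a‖ / 2) ^ 3 + n * ((2 * (1:ℕ) * ((1:ℕ) + 1)) * ‖w - a‖ / (‖ζ - a‖ / 2) ^ 3) := by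
          gcongr
      _ = (16 * n * (n+1) + 32 * n) * ‖w - a‖ / ‖ζ - a‖ / ‖ζ - a‖ ^ 2 := by
          field_simp; push_cast; ring
      _ ≤ (16 * n * (n+1) + 32 * n) * ‖w - a‖ / ‖ζ - a‖ / (‖w - ζ‖ / 2) ^ 2 := by
          gcongr; linarith
      _ = (4 * (16 * n * (n+1) + 32 * n)) * ‖w - a‖ / ‖ζ - a‖ / ‖w - ζ‖ ^ 2 := by
          field_simp; ring
      _ ≤ (200 * n * (n+1)) * ‖w - a‖ / ‖ζ - a‖ / ‖w - ζ‖ ^ 2 := by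
          have : 4 * (16 * n * (n+1) + 32 * n : ℝ) ≤ 200 * n * (n+1) := by nlinarith
          gcongr ?_ * _ / _ / _



/-- the half plane -/
def HP (e a : ℂ) : Set ℂ := {w : ℂ | 0 < (e * (w - a)).im}

theorem isOpen_HP (e a : ℂ) : IsOpen (HP e a) := by
  unfold HP
  exact isOpen_lt continuous_const (Complex.continuous_im.comp (by fun_prop))

theorem Kker_eq (Ω : Set ℂ) (n : ℕ) (z ζ : ℂ) :
    Kker Ω n z ζ = ∫ w in Ωᶜ, ((z - w) ^ 2)⁻¹ * kk n (w - ζ) := rfl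

theorem open_low {Ω : Set ℂ} (hΩo : IsOpen Ω) {z : ℂ} (hz : z ∈ Ω) :
    ∃ m > 0, ∀ w ∈ Ωᶜ, m ≤ ‖w - z‖ := by
  obtain ⟨m, hm, h⟩ := Metric.isOpen_iff.1 hΩo z hz
  refine ⟨m, hm, fun w hw => ?_⟩
  by_contra hc
  exact hw (h (by rw [mem_ball, dist_eq_norm]; linarith))

theorem integrableOn_compl (n : ℕ) (hn : 1 ≤ n) {Ω : Set ℂ} (hΩo : IsOpen Ω) {z ζ : ℂ} (hz : z ∈ Ω) (hζ : ζ ∈ Ω) :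
    IntegrableOn (fun w => ((z - w) ^ 2)⁻¹ * kk n (w - ζ)) Ωᶜ := by
  obtain ⟨m, hm, h⟩ := open_low hΩo hz
  obtain ⟨m', hm', h'⟩ := open_low hΩo hζ
  exact integrableOn_kernel n hn _ hΩo.measurableSet.compl _ _ (min m m') (by positivity)
    (fun w hw => (min_le_left _ _).trans (h w hw)) (fun w hw => (min_le_right _ _).trans (h' w hw))

theorem integrableOn_half (n : ℕ) (hn : 1 ≤ n) {e a z ζ : ℂ} (he : ‖e‖ = 1) (hz : (e * (z - a)).im < 0)
    (hζ : (e * (ζ - a)).im < 0) :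
    IntegrableOn (fun w => ((z - w) ^ 2)⁻¹ * kk n (w - ζ)) (HP e a) := by
  have key : ∀ p : ℂ, (e * (p - a)).im < 0 → ∀ w ∈ HP e a, -(e * (p - a)).im ≤ ‖w - p‖ := by
    intro p hp w hw
    have hw' : 0 < (e * (w - a)).im := hw
    have h : ‖w - p‖ = ‖e * (w - a) - e * (p - a)‖ := by
      rw [← mul_sub, norm_mul, he, one_mul]; congr 1; ring
    have := (le_abs_self _).trans (Complex.abs_im_le_norm (e * (w - a) - e * (p - a)))
    rw [h]
    rw [Complex.sub_im] at this
    linarith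
  exact integrableOn_kernel n hn _ (isOpen_HP e a).measurableSet _ _
    (min (-(e * (z - a)).im) (-(e * (ζ - a)).im)) (lt_min (by linarith) (by linarith))
    (fun w hw => (min_le_left _ _).trans (key z hz w hw)) (fun w hw => (min_le_right _ _).trans (key ζ hζ w hw))

theorem Gk_int (n : ℕ) (hn : 1 ≤ n) {e a z ζ : ℂ} (he : ‖e‖ = 1) (hz : (e * (z - a)).im < 0)
    (hζ : (e * (ζ - a)).im ≠ 0) :
    IntegrableOn (fun w => ((z - w) ^ 2)⁻¹ * Gk n e a ζ w) (HP e a) ∧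
    ∫ w in HP e a, ((z - w) ^ 2)⁻¹ * Gk n e a ζ w = 0 := by
  unfold Gk
  by_cases h : (e * (ζ - a)).im < 0
  · simp only [h, if_true]
    exact ⟨integrableOn_half n hn he hz h, half_zero n hn e a z ζ he hz h⟩
  · simp only [h, if_false]
    have hs : (e * (reflPt e a ζ - a)).im < 0 := by
      rw [refl_eq he, Complex.conj_im]
      have : 0 < (e * (ζ - a)).im := lt_of_le_of_ne (not_lt.1 h) hζ.symm
      linarith
    have e1 : (fun w => ((z - w) ^ 2)⁻¹ * ((a - reflPt e a ζ) ^ 2 * kk n (a - ζ) * kk 1 (w - reflPt e a ζ)))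
      = (fun w => ((a - reflPt e a ζ) ^ 2 * kk n (a - ζ)) * (((z - w) ^ 2)⁻¹ * kk 1 (w - reflPt e a ζ))) := by
      ext w; ring
    rw [e1]
    refine ⟨(integrableOn_half 1 le_rfl he hz hs).const_mul _, ?_⟩
    rw [integral_const_mul]
    have := half_zero 1 le_rfl e a z _ he hz hs
    unfold HP
    rw [this, mul_zero]

open Classical in
/-- the estimate for a single `ζ` -/
theorem K_diff (n : ℕ) (hn : 1 ≤ n) {Ω : Set ℂ} (hΩo : IsOpen Ω) {e a z z' ζ : ℂ} (he : ‖e‖ = 1)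
    (ha : a ∉ Ω) (hz : z ∈ Ω) (hz' : z' ∈ Ω) (hζ : ζ ∈ Ω) (hzy : (e * (z - a)).im < 0)
    (hzy' : (e * (z' - a)).im < 0) (hζy : (e * (ζ - a)).im ≠ 0) {α η : ℝ} (hα : 0 < α) (h0 : 0 ≤ η)
    (h2 : η ≤ 2) (B : ℝ≥0∞)
    (hB : ∀ w, w ∉ Ω ∨ w ∈ HP e a → ‖((z - w) ^ 2)⁻¹ - ((z' - w) ^ 2)⁻¹‖ₑ ≤ B * pw ‖w - a‖ (2 + α)) :
    ‖Kker Ω n z ζ - Kker Ω n z' ζ‖ₑ ≤ (B * ENNReal.ofReal (200 * n * (n + 1))) *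
      ((∫⁻ w in Ωᶜ \ HP e a, pw ‖w - a‖ (2 + α) * pw ‖w - ζ‖ 2) +
       (∫⁻ w in Ω ∩ HP e a, pw ‖w - a‖ (2 + α) * (pw (e * (w - a)).im η * pw ‖w - ζ‖ (2 - η))) +
       (if ζ ∈ HP e a then ∫⁻ w in Ωᶜ, pw ‖ζ - a‖ 1 * (pw ‖w - a‖ (1 + α) * pw ‖w - ζ‖ 2) else 0)) := by
  have hH := (isOpen_HP e a).measurableSet
  have hO := hΩo.measurableSet
  have hζa : ζ ≠ a := fun h => ha (h ▸ hζ)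
  set D : ℂ → ℂ := fun w => ((z - w) ^ 2)⁻¹ - ((z' - w) ^ 2)⁻¹ with hD
  set c := ENNReal.ofReal (200 * n * (n + 1)) with hc
  have hnc : (n : ℝ≥0∞) ≤ c := by
    rw [hc, ← ENNReal.ofReal_natCast]
    apply ENNReal.ofReal_le_ofReal
    have : (0:ℝ) ≤ n := by positivity
    nlinarith
  have hF : IntegrableOn (fun w => D w * kk n (w - ζ)) Ωᶜ := by
    simp only [hD, sub_mul]
    exact (integrableOn_compl n hn hΩo hz hζ).sub (integrableOn_compl n hn hΩo hz' hζ)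
  have e1 : Kker Ω n z ζ - Kker Ω n z' ζ = ∫ w in Ωᶜ, D w * kk n (w - ζ) := by
    rw [Kker_eq, Kker_eq, ← integral_sub (integrableOn_compl n hn hΩo hz hζ) (integrableOn_compl n hn hΩo hz' hζ)]
    simp only [hD, sub_mul]
  obtain ⟨g1, g2⟩ := Gk_int n hn he hzy hζy
  obtain ⟨g1', g2'⟩ := Gk_int n hn he hzy' hζy
  have hG : IntegrableOn (fun w => D w * Gk n e a ζ w) (HP e a) := by
    simp only [hD, sub_mul]
    exact g1.sub g1'
  have e2 : ∫ w in HP e a, D w * Gk n e a ζ w = 0 := by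
    simp only [hD, sub_mul]
    rw [integral_sub g1 g1', g2, g2', sub_zero]
  have e3 : Kker Ω n z ζ - Kker Ω n z' ζ =
      ∫ w, (Ωᶜ.indicator (fun w => D w * kk n (w - ζ)) w - (HP e a).indicator (fun w => D w * Gk n e a ζ w) w) := by
    rw [integral_sub (hF.integrable_indicator hO.compl) (hG.integrable_indicator hH),
      integral_indicator hO.compl, integral_indicator hH, e2, sub_zero, e1]
  rw [e3]
  refine (enorm_integral_le_lintegral_enorm _).trans ?_
  set φ1 : ℂ → ℝ≥0∞ := (Ωᶜ \ HP e a).indicator (fun w => pw ‖w - a‖ (2 + α) * pw ‖w - ζ‖ 2) with h1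
  set φ2 : ℂ → ℝ≥0∞ := (Ω ∩ HP e a).indicator
    (fun w => pw ‖w - a‖ (2 + α) * (pw (e * (w - a)).im η * pw ‖w - ζ‖ (2 - η))) with h2'
  set φ3 : ℂ → ℝ≥0∞ := fun w => if ζ ∈ HP e a then Ωᶜ.indicator (fun w =>
    pw ‖ζ - a‖ 1 * (pw ‖w - a‖ (1 + α) * pw ‖w - ζ‖ 2)) w else 0 with h3
  have m1 : Measurable φ1 := Measurable.indicator (by fun_prop) (hO.compl.diff hH)
  have m2 : Measurable φ2 := Measurable.indicator (by fun_prop) (hO.inter hH)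
  have m3 : Measurable φ3 := by
    rw [h3]
    by_cases h : ζ ∈ HP e a
    · simp only [h, if_true]
      exact Measurable.indicator (by fun_prop) hO.compl
    · simp only [h, if_false]; exact measurable_const
  have i3 : ∫⁻ w, φ3 w = if ζ ∈ HP e a then ∫⁻ w in Ωᶜ, pw ‖ζ - a‖ 1 * (pw ‖w - a‖ (1 + α) * pw ‖w - ζ‖ 2) else 0 := by
    rw [h3]
    by_cases h : ζ ∈ HP e a
    · simp only [h, if_true]; rw [lintegral_indicator hO.compl]
    · simp only [h, if_false]; simp
  have m12 : Measurable (fun w => φ1 w + φ2 w) := m1.add m2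
  have m123 : Measurable (fun w => φ1 w + φ2 w + φ3 w) := m12.add m3
  rw [← i3, ← lintegral_indicator (hO.compl.diff hH), ← lintegral_indicator (hO.inter hH), ← h1, ← h2',
    ← lintegral_add_left m1, ← lintegral_add_left m12, ← lintegral_const_mul _ m123]
  apply lintegral_mono
  intro w
  beta_reduce
  by_cases hw : w ∈ Ω
  · have hw1 : w ∉ Ωᶜ := fun h => h hw
    by_cases hwH : w ∈ HP e a
    · rw [indicator_of_notMem hw1, indicator_of_mem hwH, zero_sub, enorm_neg, enorm_mul]
      refine le_trans ?_ (mul_le_mul_right (le_add_right le_add_self) _)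
      rw [h2', indicator_of_mem (show w ∈ Ω ∩ HP e a from ⟨hw, hwH⟩)]
      have q := Gk_bound hn he a ζ w hζa hwH h0 h2
      calc ‖D w‖ₑ * ‖Gk n e a ζ w‖ₑ ≤ (B * pw ‖w - a‖ (2 + α)) *
            (c * (pw (e * (w - a)).im η * pw ‖w - ζ‖ (2 - η))) := by
            gcongr
            · exact hB w (Or.inr hwH)
            · exact q.trans (by gcongr)
        _ = _ := by ring
    · rw [indicator_of_notMem hw1, indicator_of_notMem hwH]; simp
  · have hw1 : w ∈ Ωᶜ := hw
    have hne : w ≠ ζ := fun h => hw (h ▸ hζ)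
    by_cases hwH : w ∈ HP e a
    · rw [indicator_of_mem hw1, indicator_of_mem hwH, ← mul_sub, enorm_mul]
      refine le_trans ?_ (mul_le_mul_right le_add_self _)
      by_cases hζH : ζ ∈ HP e a
      · have q := Gk_diff hn he a ζ w hζa hwH (le_of_lt hζH) hne
        rw [h3]
        simp only [hζH, if_true, indicator_of_mem hw1]
        have hwa : w ≠ a := by
          rintro rfl
          have : (0:ℝ) < (e * (w - w)).im := hwH
          simp at this
        have p1 : 0 < ‖w - a‖ := norm_pos_iff.2 (sub_ne_zero.2 hwa)
        have p2 : 0 < ‖ζ - a‖ := norm_pos_iff.2 (sub_ne_zero.2 hζa)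
        have p3 : 0 < ‖w - ζ‖ := norm_pos_iff.2 (sub_ne_zero.2 hne)
        have q' : ‖kk n (w - ζ) - Gk n e a ζ w‖ₑ ≤ c * (ENNReal.ofReal ‖w - a‖ * (pw ‖ζ - a‖ 1 * pw ‖w - ζ‖ 2)) := by
          rw [← ofReal_norm, pw_eq p2, pw_eq p3, hc, ← ENNReal.ofReal_mul (by positivity),
            ← ENNReal.ofReal_mul (by positivity), ← ENNReal.ofReal_mul (by positivity)]
          apply ENNReal.ofReal_le_ofReal
          refine q.trans (le_of_eq ?_)
          rw [Real.rpow_neg p2.le, Real.rpow_neg p3.le, Real.rpow_one]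
          norm_cast
          field_simp
        have q2 : ENNReal.ofReal ‖w - a‖ * pw ‖w - a‖ (2 + α) = pw ‖w - a‖ (1 + α) := by
          rw [pw_eq p1, pw_eq p1, ← ENNReal.ofReal_mul p1.le]
          congr 1
          have : (-(1 + α)) = 1 + -(2 + α) := by ring
          rw [this, Real.rpow_add p1, Real.rpow_one]
        calc ‖D w‖ₑ * ‖kk n (w - ζ) - Gk n e a ζ w‖ₑ ≤ (B * pw ‖w - a‖ (2 + α)) *
              (c * (ENNReal.ofReal ‖w - a‖ * (pw ‖ζ - a‖ 1 * pw ‖w - ζ‖ 2))) := by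
              gcongr
              exact hB w (Or.inl hw)
          _ = (B * c) * (pw ‖ζ - a‖ 1 * ((ENNReal.ofReal ‖w - a‖ * pw ‖w - a‖ (2 + α)) * pw ‖w - ζ‖ 2)) := by ring
          _ = _ := by rw [q2]
      · have : (e * (ζ - a)).im < 0 := lt_of_le_of_ne (not_lt.1 hζH) hζy
        have : kk n (w - ζ) - Gk n e a ζ w = 0 := by
          unfold Gk; rw [if_pos this, sub_self]
        rw [this]; simp
    · rw [indicator_of_mem hw1, indicator_of_notMem hwH, sub_zero, enorm_mul]
      refine le_trans ?_ (mul_le_mul_right (le_add_right le_self_add) _)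
      rw [h1, indicator_of_mem (show w ∈ Ωᶜ \ HP e a from ⟨hw1, hwH⟩), kk_enorm hn _ (sub_ne_zero.2 hne)]
      calc ‖D w‖ₑ * (n * pw ‖w - ζ‖ 2) ≤ (B * pw ‖w - a‖ (2 + α)) * (c * pw ‖w - ζ‖ 2) := by
            gcongr
            exact hB w (Or.inl hw)
        _ = _ := by ring



theorem holder_taylor {φ : ℝ → ℝ} {ε : ℝ} (hε : 0 < ε) (hφ : ContDiff ℝ 1 φ) {c : ℝ≥0}
    (hc : HolderOnWith c ε.toNNReal (deriv φ) univ) (s t : ℝ) :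
    |φ t - φ s - deriv φ s * (t - s)| ≤ c * |t - s| ^ (1 + ε) := by
  have hd : ∀ x, DifferentiableAt ℝ φ x := fun x => (hφ.differentiable (by norm_num)) x
  have hH : ∀ x, |deriv φ x - deriv φ s| ≤ c * |x - s| ^ ε := by
    intro x
    have := hc.dist_le (mem_univ x) (mem_univ s)
    rwa [Real.dist_eq, Real.dist_eq, Real.coe_toNNReal _ hε.le] at this
  have key := Convex.norm_image_sub_le_of_norm_deriv_le (f := fun x => φ x - deriv φ s * x)
    (C := c * |t - s| ^ ε) (s := uIcc s t) (x := s) (y := t)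
    (fun x _ => (hd x).sub ((differentiableAt_id).const_mul _)) ?_ (convex_uIcc _ _) left_mem_uIcc right_mem_uIcc
  · rw [Real.norm_eq_abs, Real.norm_eq_abs] at key
    have e1 : |t - s| ^ (1 + ε) = |t - s| ^ ε * |t - s| := by
      rcases eq_or_ne t s with h | h
      · subst h; simp [Real.zero_rpow (by linarith : 1 + ε ≠ 0)]
      · rw [Real.rpow_add (abs_pos.2 (sub_ne_zero.2 h)), Real.rpow_one, mul_comm]
    rw [e1, ← mul_assoc]
    refine le_trans (le_of_eq ?_) key
    congr 1; ring
  · intro x hx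
    have : deriv (fun x => φ x - deriv φ s * x) x = deriv φ x - deriv φ s := by
      have h1 : HasDerivAt (fun x => φ x - deriv φ s * x) (deriv φ x - deriv φ s * 1) x :=
        (hd x).hasDerivAt.sub ((hasDerivAt_id x).const_mul _)
      simpa using h1.deriv
    rw [this, Real.norm_eq_abs]
    refine (hH x).trans ?_
    exact mul_le_mul_of_nonneg_left (Real.rpow_le_rpow (abs_nonneg _) (abs_sub_left_of_mem_uIcc hx) hε.le) c.2

theorem lip_chart {φ : ℝ → ℝ} {ε : ℝ} (hε : 0 < ε) (hφ : ContDiff ℝ 1 φ) {c : ℝ≥0}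
    (hc : HolderOnWith c ε.toNNReal (deriv φ) univ) (A r : ℝ) :
    ∃ L ≥ 1, ∀ s t, |s - A| ≤ r → |t - A| ≤ r → |φ t - φ s| ≤ L * |t - s| := by
  have hd : ∀ x, DifferentiableAt ℝ φ x := fun x => (hφ.differentiable (by norm_num)) x
  refine ⟨|deriv φ A| + c * r ^ ε + 1 + c * |r| ^ ε, ?_, ?_⟩
  · by_cases hr : 0 ≤ r
    · have : 0 ≤ r ^ ε := Real.rpow_nonneg hr _
      have h1 : 0 ≤ |r| ^ ε := Real.rpow_nonneg (abs_nonneg _) _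
      have h2 : (0:ℝ) ≤ c := c.2
      have := abs_nonneg (deriv φ A)
      nlinarith [mul_nonneg h2 h1, mul_nonneg h2 (Real.rpow_nonneg hr ε)]
    · have h1 : |r ^ ε| ≤ |r| ^ ε := Real.abs_rpow_le_abs_rpow _ _
      have h2 : (0:ℝ) ≤ c := c.2
      have := abs_nonneg (deriv φ A)
      have h3 := (abs_le.1 h1).1
      nlinarith [mul_nonneg h2 (by linarith : 0 ≤ r ^ ε + |r| ^ ε)]
  · intro s t hs ht
    have hr : 0 ≤ r := (abs_nonneg _).trans hs
    have key := Convex.norm_image_sub_le_of_norm_deriv_le (f := φ)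
      (C := |deriv φ A| + c * r ^ ε + 1 + c * |r| ^ ε) (s := Icc (A - r) (A + r)) (x := s) (y := t)
      (fun x _ => hd x) ?_ (convex_Icc _ _) ?_ ?_
    · simpa [Real.norm_eq_abs] using key
    · intro x hx
      have := hc.dist_le (mem_univ x) (mem_univ A)
      rw [Real.dist_eq, Real.dist_eq, Real.coe_toNNReal _ hε.le] at this
      have hx' : |x - A| ≤ r := by rw [abs_le]; constructor <;> linarith [hx.1, hx.2]
      have h1 : |x - A| ^ ε ≤ r ^ ε := Real.rpow_le_rpow (abs_nonneg _) hx' hε.le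
      have h2 : (0:ℝ) ≤ c := c.2
      have h3 : 0 ≤ |r| ^ ε := Real.rpow_nonneg (abs_nonneg _) _
      have h4 := mul_le_mul_of_nonneg_left h1 h2
      have h5 := abs_add_le (deriv φ x - deriv φ A) (deriv φ A)
      rw [sub_add_cancel] at h5
      rw [Real.norm_eq_abs]
      nlinarith [mul_nonneg h2 h3]
    · rw [abs_le] at hs; constructor <;> linarith [hs.1, hs.2]
    · rw [abs_le] at ht; constructor <;> linarith [ht.1, ht.2]

/-- flatness at `b` -/
def Flat (Ω : Set ℂ) (ε N : ℝ) (b : ℂ) : Prop :=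
  ∃ e : ℂ, ‖e‖ = 1 ∧ ∀ w, ‖w - b‖ < 1 / N →
    (w ∈ Ω → (e * (w - b)).im ≤ N * ‖w - b‖ ^ (1 + ε)) ∧
    (w ∉ Ω → -(N * ‖w - b‖ ^ (1 + ε)) ≤ (e * (w - b)).im)

/-- interior cone condition at `b` -/
def Cone (Ω : Set ℂ) (N : ℝ) (b : ℂ) : Prop :=
  ∃ v : ℂ, ‖v‖ = 1 ∧ ∀ z ∈ Ω, ‖z - b‖ < 1 / N → ∀ t, 0 ≤ t → t ≤ 1 / N → ball (z + t * v) (t / N) ⊆ Ω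

theorem Flat.mono {Ω : Set ℂ} {ε N N' : ℝ} {b : ℂ} (hN : 1 ≤ N) (h : N ≤ N') (hF : Flat Ω ε N b) :
    Flat Ω ε N' b := by
  obtain ⟨e, he, H⟩ := hF
  refine ⟨e, he, fun w hw => ?_⟩
  have h1 : 1 / N' ≤ 1 / N := one_div_le_one_div_of_le (by linarith) h
  have h2 := H w (hw.trans_le h1)
  have h3 : N * ‖w - b‖ ^ (1 + ε) ≤ N' * ‖w - b‖ ^ (1 + ε) := by gcongr
  exact ⟨fun hw => (h2.1 hw).trans h3, fun hw => le_trans (by linarith) (h2.2 hw)⟩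

theorem Cone.mono {Ω : Set ℂ} {N N' : ℝ} {b : ℂ} (hN : 1 ≤ N) (h : N ≤ N') (hF : Cone Ω N b) :
    Cone Ω N' b := by
  obtain ⟨e, he, H⟩ := hF
  have h1 : 1 / N' ≤ 1 / N := one_div_le_one_div_of_le (by linarith) h
  refine ⟨e, he, fun w hw hwb t ht0 ht => ?_⟩
  exact (ball_subset_ball (by gcongr)).trans (H w hw (hwb.trans_le h1) t ht0 (ht.trans h1))

theorem chart_frontier {Ω : Set ℂ} (hΩo : IsOpen Ω) {a e : ℂ} {r : ℝ} {φ : ℝ → ℝ} (hφ : Continuous φ)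
    (h : Ω ∩ ball a r = {z ∈ ball a r | (e * z).im < φ ((e * z).re)}) {b : ℂ} (hb : b ∈ frontier Ω)
    (hbr : b ∈ ball a r) : (e * b).im = φ ((e * b).re) := by
  rw [hΩo.frontier_eq] at hb
  apply le_antisymm
  · have hcl : b ∈ closure (Ω ∩ ball a r) := by
      have := isOpen_ball.inter_closure ⟨hbr, hb.1⟩
      rwa [inter_comm] at this
    have hC : IsClosed {z : ℂ | (e * z).im ≤ φ ((e * z).re)} :=
      isClosed_le (Complex.continuous_im.comp (by fun_prop)) (hφ.comp (Complex.continuous_re.comp (by fun_prop)))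
    refine closure_minimal ?_ hC hcl
    rw [h]; exact fun z hz => le_of_lt hz.2
  · by_contra hlt
    have : b ∈ Ω ∩ ball a r := by rw [h]; exact ⟨hbr, not_le.1 hlt⟩
    exact hb.2 this.1

theorem chart_flat {Ω : Set ℂ} (hΩo : IsOpen Ω) {ε : ℝ} (hε : 0 < ε) {a e : ℂ} {r : ℝ} (he : ‖e‖ = 1) {φ : ℝ → ℝ}
    (hφ : ContDiff ℝ 1 φ) {c : ℝ≥0} (hc : HolderOnWith c ε.toNNReal (deriv φ) univ)
    (h : Ω ∩ ball a r = {z ∈ ball a r | (e * z).im < φ ((e * z).re)}) {b : ℂ} (hb : b ∈ frontier Ω)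
    (hbr : b ∈ ball a (r / 2)) {N : ℝ} (hN : 1 ≤ N) (hNc : c ≤ N) (hNr : 1 / N ≤ r / 2) : Flat Ω ε N b := by
  set m := deriv φ (e * b).re with hm
  set s := √(1 + m ^ 2) with hs
  have hs2 : s ^ 2 = 1 + m ^ 2 := Real.sq_sqrt (by positivity)
  have hs0 : 0 ≤ s := Real.sqrt_nonneg _
  have hs1 : 1 ≤ s := by nlinarith [sq_nonneg m]
  have hr : 0 < r := by
    have : 0 < 1 / N := by positivity
    linarith
  have hbr' : b ∈ ball a r := ball_subset_ball (by linarith) hbr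
  have hbf := chart_frontier hΩo hφ.continuous h hb hbr'
  refine ⟨e * (⟨1 / s, -m / s⟩ : ℂ), ?_, ?_⟩
  · rw [norm_mul, he, one_mul, ← sq_eq_sq₀ (norm_nonneg _) zero_le_one, Complex.sq_norm, Complex.normSq_mk]
    field_simp
    linarith
  · intro w hw
    have hwr : w ∈ ball a r := by
      rw [mem_ball] at *
      have := dist_triangle w b a
      rw [dist_eq_norm w b] at this
      linarith
    have hT := holder_taylor hε hφ hc (e * b).re (e * w).re
    have hre : |(e * w).re - (e * b).re| ≤ ‖w - b‖ := by
      have := Complex.abs_re_le_norm (e * (w - b))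
      rwa [norm_mul, he, one_mul, mul_sub, Complex.sub_re] at this
    have hT2 : c * |(e * w).re - (e * b).re| ^ (1 + ε) ≤ N * ‖w - b‖ ^ (1 + ε) := by
      have : 0 < 1 + ε := by linarith
      gcongr
    have hT' := abs_le.1 (hT.trans hT2)
    set Q := N * ‖w - b‖ ^ (1 + ε) with hQ
    have hQ0 : 0 ≤ Q := by positivity
    have him : (e * (⟨1 / s, -m / s⟩ : ℂ) * (w - b)).im = (((e * w).im - (e * b).im) - m * ((e * w).re - (e * b).re)) / s := by
      simp only [Complex.mul_im, Complex.mul_re, Complex.sub_im, Complex.sub_re]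
      field_simp
      ring
    rw [him]
    have hiff : w ∈ Ω ↔ (e * w).im < φ (e * w).re := by
      constructor
      · intro hw
        have : w ∈ Ω ∩ ball a r := ⟨hw, hwr⟩
        rw [h] at this; exact this.2
      · intro hw
        have : w ∈ Ω ∩ ball a r := by rw [h]; exact ⟨hwr, hw⟩
        exact this.1
    constructor
    · intro hw
      have := hiff.1 hw
      rw [div_le_iff₀ (by linarith)]
      nlinarith [hT'.2]
    · intro hw
      have := not_lt.1 (fun h => hw (hiff.2 h))
      rw [le_div_iff₀ (by linarith)]
      nlinarith [hT'.1]

theorem chart_cone {Ω : Set ℂ} {a e : ℂ} {r : ℝ} (he : ‖e‖ = 1) {φ : ℝ → ℝ}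
    (h : Ω ∩ ball a r = {z ∈ ball a r | (e * z).im < φ ((e * z).re)}) {L : ℝ}
    (hL : ∀ s t, |s - (e * a).re| ≤ r → |t - (e * a).re| ≤ r → |φ t - φ s| ≤ L * |t - s|) {b : ℂ}
    (hbr : b ∈ ball a (r / 2)) {N : ℝ} (hN : 1 ≤ N) (hNL : L + 1 ≤ N) (hL0 : 1 ≤ L) (hNr : 1 / N ≤ r / 8) : Cone Ω N b := by
  have hN0 : 0 < 1 / N := by positivity
  have hre : ∀ p ∈ ball a r, |(e * p).re - (e * a).re| ≤ r := by
    intro p hp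
    have := Complex.abs_re_le_norm (e * (p - a))
    rw [norm_mul, he, one_mul, mul_sub, Complex.sub_re] at this
    rw [mem_ball, dist_eq_norm] at hp
    linarith
  have hee : e * (starRingEnd ℂ) e = 1 := by
    rw [Complex.mul_conj, Complex.normSq_eq_norm_sq, he]; norm_num
  refine ⟨-(Complex.I * (starRingEnd ℂ) e), by simp [he], ?_⟩
  intro z hz hzb t ht0 ht p hp
  rw [mem_ball, dist_eq_norm] at hp hbr
  set u := e * (p - (z + t * -(Complex.I * (starRingEnd ℂ) e))) with hu
  have hun : ‖u‖ < t / N := by rwa [hu, norm_mul, he, one_mul]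
  have htN : t / N ≤ t := div_le_self ht0 hN
  have hep : e * p = e * z - t * Complex.I + u := by
    rw [hu]; linear_combination (-(t:ℂ) * Complex.I) * hee
  have hpz : ‖p - z‖ ≤ 2 * t := by
    have : ‖p - z‖ = ‖- (t * Complex.I) + u‖ := by
      rw [show -(t * Complex.I) + u = e * (p - z) by rw [mul_sub, hep]; ring, norm_mul, he, one_mul]
    rw [this]
    refine (norm_add_le _ _).trans ?_
    rw [norm_neg, norm_mul, Complex.norm_I, Complex.norm_real, Real.norm_eq_abs, abs_of_nonneg ht0]
    linarith
  have hza : z ∈ ball a r := by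
    rw [mem_ball, dist_eq_norm]
    have := norm_sub_le_norm_sub_add_norm_sub z b a
    linarith
  have hpa : p ∈ ball a r := by
    rw [mem_ball, dist_eq_norm]
    have := norm_sub_le_norm_sub_add_norm_sub z b a
    have := norm_sub_le_norm_sub_add_norm_sub p z a
    linarith
  have hz' : (e * z).im < φ (e * z).re := by
    have : z ∈ Ω ∩ ball a r := ⟨hz, hza⟩
    rw [h] at this; exact this.2
  have : p ∈ Ω ∩ ball a r := by
    rw [h]
    refine ⟨hpa, ?_⟩
    have hl := hL (e * z).re (e * p).re (hre z hza) (hre p hpa)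
    have h1 : (e * p).re - (e * z).re = u.re := by rw [hep]; simp
    have h2 : (e * p).im = (e * z).im - t + u.im := by rw [hep]; simp
    rw [h1] at hl
    have h3 := (Complex.abs_re_le_norm u)
    have h4 := (le_abs_self _).trans (Complex.abs_im_le_norm u)
    have h5 : (L + 1) * (t / N) ≤ t := by
      rw [mul_div_assoc', div_le_iff₀ (by linarith)]
      nlinarith
    have h6 := (abs_le.1 hl).1
    have h7 : L * |u.re| ≤ L * ‖u‖ := by gcongr
    rw [h2]
    nlinarith
  exact this.1

theorem frontier_compact {Ω : Set ℂ} (hΩb : Bornology.IsBounded Ω) : IsCompact (frontier Ω) :=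
  isCompact_of_isClosed_isBounded isClosed_frontier (hΩb.closure.subset frontier_subset_closure)

theorem frontier_ne {Ω : Set ℂ} (hΩo : IsOpen Ω) (hne : Ω.Nonempty) (hΩb : Bornology.IsBounded Ω) : (frontier Ω).Nonempty := by
  by_contra h
  rw [not_nonempty_iff_eq_empty, ← isClopen_iff_frontier_eq_empty] at h
  rcases isClopen_iff.1 h with h | h
  · exact hne.ne_empty h
  · rw [h] at hΩb
    exact NormedSpace.unbounded_univ ℝ ℂ hΩb

theorem geometry {Ω : Set ℂ} (hΩo : IsOpen Ω) (hΩb : Bornology.IsBounded Ω) {ε : ℝ} (hε : 0 < ε)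
    (hΩ : HasC1HolderBoundaryC ε Ω) : ∃ N, 1 ≤ N ∧ ∀ b ∈ frontier Ω, Flat Ω ε N b ∧ Cone Ω N b := by
  suffices H : ∃ N, 1 ≤ N ∧ ∀ b ∈ frontier Ω, b ∈ frontier Ω → Flat Ω ε N b ∧ Cone Ω N b by
    obtain ⟨N, h1, h2⟩ := H
    exact ⟨N, h1, fun b hb => h2 b hb hb⟩
  refine (frontier_compact hΩb).induction_on (p := fun S => ∃ N, 1 ≤ N ∧ ∀ b ∈ S, b ∈ frontier Ω → Flat Ω ε N b ∧ Cone Ω N b) ?_ ?_ ?_ ?_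
  · exact ⟨1, le_rfl, by simp⟩
  · rintro s t hst ⟨N, h1, h2⟩
    exact ⟨N, h1, fun b hb => h2 b (hst hb)⟩
  · rintro s t ⟨N, h1, h2⟩ ⟨N', h1', h2'⟩
    refine ⟨max N N', le_max_of_le_left h1, ?_⟩
    rintro b (hb | hb) hbf
    · exact ⟨(h2 b hb hbf).1.mono h1 (le_max_left _ _), (h2 b hb hbf).2.mono h1 (le_max_left _ _)⟩
    · exact ⟨(h2' b hb hbf).1.mono h1' (le_max_right _ _), (h2' b hb hbf).2.mono h1' (le_max_right _ _)⟩
  · intro a ha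
    obtain ⟨r, hr, e, he, φ, hφ, ⟨c, hc⟩, h⟩ := hΩ a ha
    obtain ⟨L, hL1, hL⟩ := lip_chart hε hφ hc (e * a).re r
    refine ⟨ball a (r / 2), mem_nhdsWithin_of_mem_nhds (ball_mem_nhds _ (by linarith)),
      max (max 1 c) (max (L + 1) (8 / r)), le_max_of_le_left (le_max_left _ _), ?_⟩
    intro b hb hbf
    have h1 : 1 / max (max 1 (c:ℝ)) (max (L + 1) (8 / r)) ≤ r / 8 := by
      rw [show r / 8 = 1 / (8 / r) by field_simp]
      exact one_div_le_one_div_of_le (by positivity) (le_max_of_le_right (le_max_right _ _))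
    exact ⟨chart_flat hΩo hε he hφ hc h hbf hb (le_max_of_le_left (le_max_left _ _))
      (le_max_of_le_left (le_max_right _ _)) (h1.trans (by linarith)),
      chart_cone he h hL hb (le_max_of_le_left (le_max_left _ _)) (le_max_of_le_right (le_max_left _ _)) hL1 h1⟩



theorem chart_int {Ω : Set ℂ} (hΩo : IsOpen Ω) (hΩb : Bornology.IsBounded Ω) {a e : ℂ} {r : ℝ} (hr : 0 < r) (he : ‖e‖ = 1) {φ : ℝ → ℝ}
    (hφ : Continuous φ) (ha : a ∈ frontier Ω)
    (h : Ω ∩ ball a r = {z ∈ ball a r | (e * z).im < φ ((e * z).re)}) {L : ℝ} (hL0 : 1 ≤ L)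
    (hL : ∀ s t, |s - (e * a).re| ≤ r → |t - (e * a).re| ≤ r → |φ t - φ s| ≤ L * |t - s|) :
    ∫⁻ w in ball a (r / 4), pw (infDist w (frontier Ω)) (1/2) < ⊤ := by
  have hre : ∀ p ∈ ball a r, |(e * p).re - (e * a).re| ≤ r := by
    intro p hp
    have := Complex.abs_re_le_norm (e * (p - a))
    rw [norm_mul, he, one_mul, mul_sub, Complex.sub_re] at this
    rw [mem_ball, dist_eq_norm] at hp
    linarith
  have key : ∀ w ∈ ball a (r / 4), |(e * w).im - φ (e * w).re| ≤ (1 + L) * infDist w (frontier Ω) ∧ infDist w (frontier Ω) ≤ r := by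
    intro w hw
    have hwa : w ∈ ball a r := ball_subset_ball (by linarith) hw
    obtain ⟨b, hb, hbd⟩ := (frontier_compact hΩb).exists_infDist_eq_dist ⟨a, ha⟩ w
    have h1 : infDist w (frontier Ω) ≤ dist w a := infDist_le_dist_of_mem ha
    rw [mem_ball] at hw
    have hbr : b ∈ ball a r := by
      rw [mem_ball]
      have := dist_triangle b w a
      rw [dist_comm b w] at this
      linarith
    have hbf := chart_frontier hΩo hφ h hb hbr
    refine ⟨?_, by linarith⟩
    have h2 := hL (e * w).re (e * b).re (hre w hwa) (hre b hbr)
    have h3 : |(e * b).re - (e * w).re| ≤ dist w b := by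
      have := Complex.abs_re_le_norm (e * (b - w))
      rwa [norm_mul, he, one_mul, mul_sub, Complex.sub_re, ← dist_eq_norm, dist_comm] at this
    have h4 : |(e * w).im - (e * b).im| ≤ dist w b := by
      have := Complex.abs_im_le_norm (e * (w - b))
      rwa [norm_mul, he, one_mul, mul_sub, Complex.sub_im, ← dist_eq_norm] at this
    have h5 : |(e * w).im - φ (e * w).re| ≤ |(e * w).im - (e * b).im| + |φ (e * b).re - φ (e * w).re| := by
      rw [← hbf]; exact abs_sub_le _ _ _
    have h6 : L * |(e * b).re - (e * w).re| ≤ L * dist w b := by gcongr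
    rw [hbd]
    linarith
  set D := (1 + L) * r with hD
  set c := (e * a).re with hc
  set f : ℂ → ℝ≥0∞ := fun u => (Icc (c - r) (c + r)).indicator 1 u.re *
    (Icc (-D) D).indicator (fun t => pw |t| (1/2)) (u.im - φ u.re) with hf
  have hfm : Measurable f := by
    apply Measurable.mul
    · exact (measurable_one.indicator measurableSet_Icc).comp Complex.measurable_re
    · exact (Measurable.indicator (by fun_prop) measurableSet_Icc).comp
        (Complex.measurable_im.sub (hφ.measurable.comp Complex.measurable_re))
  have hfi : ∫⁻ u, f u < ⊤ := by
    rw [lint_prod f hfm]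
    simp only [hf]
    have : ∀ x : ℝ, ∫⁻ y : ℝ, (Icc (c - r) (c + r)).indicator (1 : ℝ → ℝ≥0∞) x *
        (Icc (-D) D).indicator (fun t => pw |t| (1/2)) (y - φ x) =
        (Icc (c - r) (c + r)).indicator 1 x * ∫⁻ y in Icc (-D) D, pw |y| (1/2) := by
      intro x
      rw [lintegral_const_mul _ (by
        exact (Measurable.indicator (by fun_prop) measurableSet_Icc).comp (measurable_id.sub_const _)),
        lintegral_sub_right_eq_self (fun y => (Icc (-D) D).indicator (fun t => pw |t| (1/2)) y),
        lintegral_indicator measurableSet_Icc]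
    simp_rw [this]
    rw [lintegral_mul_const _ (measurable_one.indicator measurableSet_Icc), lintegral_indicator_one measurableSet_Icc]
    exact ENNReal.mul_lt_top (by simp) (lint1 _ _ (by norm_num) (by norm_num))
  have hle : ∫⁻ w in ball a (r / 4), pw (infDist w (frontier Ω)) (1/2) ≤
      ∫⁻ w, pw (1 / (1 + L)) (1/2) * f (e * (w - 0)) := by
    rw [← lintegral_indicator measurableSet_ball]
    apply lintegral_mono
    intro w
    beta_reduce
    by_cases hw : w ∈ ball a (r / 4)
    · rw [indicator_of_mem hw, sub_zero]
      have hwa : w ∈ ball a r := ball_subset_ball (by linarith) hw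
      obtain ⟨k1, k2⟩ := key w hw
      have h1 := abs_le.1 (hre w hwa)
      have k3 : |(e * w).im - φ (e * w).re| ≤ D := k1.trans (by rw [hD]; gcongr)
      have k4 := abs_le.1 k3
      simp only [hf]
      rw [indicator_of_mem (show (e * w).re ∈ Icc (c - r) (c + r) by constructor <;> linarith [h1.1, h1.2]),
        indicator_of_mem (show (e * w).im - φ (e * w).re ∈ Icc (-D) D from k4)]
      simp only [Pi.one_apply, one_mul]
      rw [← pw_mul_left (by positivity) _ _ (by norm_num)]
      apply pw_anti (by norm_num)
      rw [one_div, inv_mul_le_iff₀ (by linarith)]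
      exact k1
    · rw [indicator_of_notMem hw]; exact zero_le
  refine hle.trans_lt ?_
  rw [lint_rot e 0 he (fun u => pw (1 / (1 + L)) (1/2) * f u), lintegral_const_mul _ hfm]
  exact ENNReal.mul_lt_top (lt_top_iff_ne_top.2 (pw_ne_top (by positivity) _)) hfi

theorem dist_int {Ω : Set ℂ} (hΩo : IsOpen Ω) (hne : Ω.Nonempty) (hΩb : Bornology.IsBounded Ω) {ε : ℝ} (hε : 0 < ε)
    (hΩ : HasC1HolderBoundaryC ε Ω) :
    ∫⁻ w in {w | infDist w (frontier Ω) ≤ 1}, pw (infDist w (frontier Ω)) (1/2) < ⊤ := by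
  have hfc := frontier_compact hΩb
  have H : ∃ U, IsOpen U ∧ frontier Ω ∩ frontier Ω ⊆ U ∧ ∫⁻ w in U, pw (infDist w (frontier Ω)) (1/2) < ⊤ := by
    refine hfc.induction_on (p := fun S => ∃ U, IsOpen U ∧ S ∩ frontier Ω ⊆ U ∧ ∫⁻ w in U, pw (infDist w (frontier Ω)) (1/2) < ⊤) ?_ ?_ ?_ ?_
    · exact ⟨∅, isOpen_empty, by simp, by simp⟩
    · rintro s t hst ⟨U, h1, h2, h3⟩
      exact ⟨U, h1, (inter_subset_inter_left _ hst).trans h2, h3⟩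
    · rintro s t ⟨U, h1, h2, h3⟩ ⟨U', h1', h2', h3'⟩
      refine ⟨U ∪ U', h1.union h1', ?_, ?_⟩
      · rw [union_inter_distrib_right]; exact union_subset_union h2 h2'
      · exact (lintegral_union_le _ _ _).trans_lt (ENNReal.add_lt_top.2 ⟨h3, h3'⟩)
    · intro a ha
      obtain ⟨r, hr, e, he, φ, hφ, ⟨c, hc⟩, h⟩ := hΩ a ha
      obtain ⟨L, hL1, hL⟩ := lip_chart hε hφ hc (e * a).re r
      exact ⟨ball a (r / 4), mem_nhdsWithin_of_mem_nhds (ball_mem_nhds _ (by linarith)), _, isOpen_ball, inter_subset_left,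
        chart_int hΩo hΩb hr he hφ.continuous ha h hL1 hL⟩
  obtain ⟨U, hU, hsub, hUi⟩ := H
  rw [inter_self] at hsub
  obtain ⟨d, hd, hdU⟩ := hfc.exists_thickening_subset_open hU hsub
  have hfne := frontier_ne hΩo hne hΩb
  set S := {w | infDist w (frontier Ω) ≤ 1} with hS
  have hSb : volume S < ⊤ := by
    have : S ⊆ thickening 2 (frontier Ω) := by
      intro w hw
      rw [mem_thickening_iff_infDist_lt hfne]
      exact lt_of_le_of_lt hw (by norm_num)
    exact (measure_mono this).trans_lt hfc.isBounded.thickening.measure_lt_top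
  have hSm : MeasurableSet S := measurableSet_le (measurable_infDist) measurable_const
  have hsub2 : S ⊆ U ∪ (S \ U) := by intro w hw; by_cases h : w ∈ U <;> simp [h, hw]
  refine (lintegral_mono_set hsub2).trans_lt ((lintegral_union_le _ _ _).trans_lt (ENNReal.add_lt_top.2 ⟨hUi, ?_⟩))
  have : ∫⁻ w in S \ U, pw (infDist w (frontier Ω)) (1/2) ≤ ∫⁻ w in S \ U, pw d (1/2) := by
    apply setLIntegral_mono' (hSm.diff hU.measurableSet)
    intro w hw
    apply pw_anti (by norm_num)
    by_contra hlt
    apply hw.2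
    apply hdU
    rw [mem_thickening_iff_infDist_lt hfne]
    linarith
  refine this.trans_lt ?_
  rw [setLIntegral_const]
  exact ENNReal.mul_lt_top (lt_top_iff_ne_top.2 (pw_ne_top hd _)) ((measure_mono sdiff_subset).trans_lt hSb)



theorem pw_zero (x : ℝ) : pw x 0 = 1 := by simp [pw]

theorem pw_ne_zero (x : ℝ) {s : ℝ} (hs : 0 ≤ s) : pw x s ≠ 0 := by
  unfold pw
  intro h
  rw [ENNReal.rpow_eq_zero_iff] at h
  rcases h with h | h
  · exact ENNReal.ofReal_ne_top (ENNReal.inv_eq_zero.1 h.1)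
  · linarith [h.2]

theorem pw_exp {x s t : ℝ} (hx : x ≤ 1) (hs : s ≤ t) : pw x s ≤ pw x t := by
  unfold pw
  apply ENNReal.rpow_le_rpow_of_exponent_le _ hs
  rw [ENNReal.one_le_inv]
  exact ENNReal.ofReal_le_one.2 hx

theorem pw_young {s t s' t' : ℝ} (hs : 0 < s) (hs' : 0 < s') (ht : 0 < t) (ht' : 0 < t') (h : s / s' + t / t' = 1)
    (x y : ℝ) : pw x s * pw y t ≤ pw x s' + pw y t' := by
  have hq : (s' / s).HolderConjugate (t' / t) := by
    refine ⟨?_, ?_, ?_⟩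
    · simpa using h
    · positivity
    · positivity
  have := ENNReal.young_inequality (pw x s) (pw y t) hq
  rw [pw_rpow, pw_rpow, mul_div_cancel₀ _ hs.ne', mul_div_cancel₀ _ ht.ne'] at this
  refine this.trans (add_le_add ?_ ?_)
  · apply ENNReal.div_le_of_le_mul
    refine le_mul_of_one_le_right zero_le ?_
    rw [ENNReal.one_le_ofReal]; exact hq.lt.le
  · apply ENNReal.div_le_of_le_mul
    refine le_mul_of_one_le_right zero_le ?_
    rw [ENNReal.one_le_ofReal]; exact hq.symm.lt.le

/-- the strip -/
def strip (ε N : ℝ) (e a : ℂ) : Set ℂ := {w | ‖w - a‖ ≤ 1 ∧ |(e * (w - a)).im| ≤ N * ‖w - a‖ ^ (1 + ε)}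

theorem measurableSet_strip (ε N : ℝ) (e a : ℂ) : MeasurableSet (strip ε N e a) := by
  have h1 : MeasurableSet {w : ℂ | ‖w - a‖ ≤ 1} := measurableSet_le (by fun_prop) measurable_const
  have h2 : MeasurableSet {w : ℂ | |(e * (w - a)).im| ≤ N * ‖w - a‖ ^ (1 + ε)} :=
    measurableSet_le (by fun_prop) (by fun_prop)
  exact h1.inter h2

theorem strip_int {β ε N : ℝ} (hβ : 0 < β) (hβε : β < ε) (hε1 : ε < 1) (hN : 1 ≤ N) :
    ∃ C < ⊤, ∀ e a : ℂ, ‖e‖ = 1 → ∫⁻ w in strip ε N e a, pw ‖w - a‖ (2 + β) ≤ C := by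
  set κ := (1 + (1 + β) / (1 + ε)) / 2 with hκ
  have hq : (1 + β) / (1 + ε) < 1 := by rw [div_lt_one (by linarith)]; linarith
  have hq0 : 0 < (1 + β) / (1 + ε) := div_pos (by linarith) (by linarith)
  have hκ1 : κ < 1 := by linarith
  have hκ0 : 0 < κ := by linarith
  have hκε : (1 + ε) * κ = 1 + (ε + β) / 2 := by
    have : 1 + ε ≠ 0 := by linarith
    rw [hκ]; field_simp; ring
  set m := 1 + (β - ε) / 2 with hm
  obtain ⟨C, hC, H⟩ := lint_box m κ 1 (by linarith) (by linarith) hκ0.le hκ1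
  have hpN : pw N κ ≠ 0 := pw_ne_zero _ hκ0.le
  have hpN' : pw N κ ≠ ⊤ := pw_ne_top (by linarith) _
  refine ⟨(pw N κ)⁻¹ * C, ENNReal.mul_lt_top (ENNReal.inv_lt_top.2 (pos_iff_ne_zero.2 hpN)) hC, fun e a he => ?_⟩
  refine le_trans ?_ (mul_le_mul_right (H e a he) _)
  rw [← lintegral_const_mul _ (by fun_prop), ← lintegral_indicator (measurableSet_strip _ _ _ _), ← lintegral_indicator measurableSet_closedBall]
  apply lintegral_mono
  intro w
  beta_reduce
  by_cases hw : w ∈ strip ε N e a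
  · rw [indicator_of_mem hw, indicator_of_mem (show w ∈ closedBall a 1 by rw [mem_closedBall, dist_eq_norm]; exact hw.1)]
    have hre : |(e * (w - a)).re| ≤ ‖w - a‖ := by
      have := Complex.abs_re_le_norm (e * (w - a))
      rwa [norm_mul, he, one_mul] at this
    have h1 := pw_anti (s := m) (by linarith) hre
    have h2 := pw_anti hκ0.le hw.2
    rw [pw_mul_left (by linarith) _ _ hκ0.le] at h2
    have h3 : pw (‖w - a‖ ^ (1 + ε)) κ = pw ‖w - a‖ ((1 + ε) * κ) := by
      rcases eq_or_ne ‖w - a‖ 0 with h0 | h0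
      · rw [h0, Real.zero_rpow (by linarith), pw_top le_rfl hκ0, pw_top le_rfl (mul_pos (by linarith) hκ0)]
      · have h0' : 0 < ‖w - a‖ := lt_of_le_of_ne (norm_nonneg _) h0.symm
        rw [pw_eq (by positivity), pw_eq h0', ← Real.rpow_mul h0'.le]
        congr 2; ring
    rw [h3] at h2
    have h4 : pw ‖w - a‖ (2 + β) = pw ‖w - a‖ m * pw ‖w - a‖ ((1 + ε) * κ) := by
      rw [← pw_add _ (by linarith) (by rw [hκε]; linarith), hκε]
      congr 1; rw [hm]; ring
    rw [h4]
    calc pw ‖w - a‖ m * pw ‖w - a‖ ((1 + ε) * κ)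
        = (pw N κ)⁻¹ * (pw ‖w - a‖ m * (pw N κ * pw ‖w - a‖ ((1 + ε) * κ))) := by
          rw [mul_left_comm (pw ‖w - a‖ m), ← mul_assoc, ENNReal.inv_mul_cancel hpN hpN', one_mul]
      _ ≤ _ := by gcongr
  · rw [indicator_of_notMem hw]; exact zero_le

/-- flatness with a given direction -/
def FlatE (Ω : Set ℂ) (ε N : ℝ) (b e : ℂ) : Prop :=
  ∀ w, ‖w - b‖ < 1 / N →
    (w ∈ Ω → (e * (w - b)).im ≤ N * ‖w - b‖ ^ (1 + ε)) ∧
    (w ∉ Ω → -(N * ‖w - b‖ ^ (1 + ε)) ≤ (e * (w - b)).im)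

/-- the symmetric difference of the complement and the half plane -/
def EE (Ω : Set ℂ) (e a : ℂ) : Set ℂ := (Ωᶜ \ HP e a) ∪ (Ω ∩ HP e a)

theorem EE_strip {Ω : Set ℂ} {ε N : ℝ} {a e : ℂ} (hN : 1 ≤ N) (hF : FlatE Ω ε N a e) {w : ℂ}
    (hw : w ∈ EE Ω e a) (hwa : ‖w - a‖ < 1 / N) : w ∈ strip ε N e a := by
  have h1 : 1 / N ≤ 1 := by rw [div_le_one (by linarith)]; exact hN
  have hQ : 0 ≤ N * ‖w - a‖ ^ (1 + ε) := by positivity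
  refine ⟨by linarith, ?_⟩
  rw [abs_le]
  rcases hw with hw | hw
  · have h3 : (e * (w - a)).im ≤ 0 := not_lt.1 hw.2
    exact ⟨(hF w hwa).2 hw.1, by linarith⟩
  · have h3 : 0 < (e * (w - a)).im := hw.2
    exact ⟨by linarith, (hF w hwa).1 hw.1⟩

theorem measurableSet_EE {Ω : Set ℂ} (hΩo : IsOpen Ω) (e a : ℂ) : MeasurableSet (EE Ω e a) :=
  (hΩo.measurableSet.compl.diff (isOpen_HP e a).measurableSet).union
    (hΩo.measurableSet.inter (isOpen_HP e a).measurableSet)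

theorem J1 {Ω : Set ℂ} (hΩo : IsOpen Ω) {α ε N η : ℝ} (hα : 0 < α) (hαε : α < ε) (hε1 : ε < 1) (hN : 1 ≤ N)
    (hη : 0 < η) (hη1 : η ≤ 1/2) (hηc : (2 + α) / (2 + (α + ε) / 2) + η / (1/2) = 1)
    (hI : ∫⁻ w in {w | infDist w (frontier Ω) ≤ 1}, pw (infDist w (frontier Ω)) (1/2) < ⊤) :
    ∃ C < ⊤, ∀ a ∈ frontier Ω, ∀ e, ‖e‖ = 1 → FlatE Ω ε N a e →
      ∫⁻ w in EE Ω e a, pw ‖w - a‖ (2 + α) * pw (infDist w (frontier Ω)) η ≤ C := by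
  obtain ⟨C1, hC1, H1⟩ := strip_int (β := (α + ε) / 2) (ε := ε) (N := N) (by linarith) (by linarith) hε1 hN
  obtain ⟨C2, hC2, H2⟩ := lint_tail (2 + α) (1 / N) (by linarith) (by positivity)
  set I := ∫⁻ w in {w | infDist w (frontier Ω) ≤ 1}, pw (infDist w (frontier Ω)) (1/2) with hI'
  set P := pw (1 / N) (2 + α) with hP
  have hPt : P ≠ ⊤ := pw_ne_top (by positivity) _
  refine ⟨C1 + C2 + (1 + P) * I, ENNReal.add_lt_top.2 ⟨ENNReal.add_lt_top.2 ⟨hC1, hC2⟩,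
    ENNReal.mul_lt_top (ENNReal.add_lt_top.2 ⟨by simp, lt_top_iff_ne_top.2 hPt⟩) hI⟩, fun a ha e he hF => ?_⟩
  have hmS := measurableSet_strip ε N e a
  have hmI : MeasurableSet {w : ℂ | infDist w (frontier Ω) ≤ 1} := measurableSet_le (measurable_infDist) measurable_const
  have hmR : MeasurableSet {w : ℂ | 1 / N ≤ ‖w - a‖} := measurableSet_le measurable_const (by fun_prop)
  set f1 := (strip ε N e a).indicator (fun w => pw ‖w - a‖ (2 + (α + ε) / 2)) with hf1
  set f2 := {w : ℂ | 1 / N ≤ ‖w - a‖}.indicator (fun w => pw ‖w - a‖ (2 + α)) with hf2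
  set f3 := {w : ℂ | infDist w (frontier Ω) ≤ 1}.indicator (fun w => pw (infDist w (frontier Ω)) (1/2)) with hf3
  have md : Measurable (fun w : ℂ => infDist w (frontier Ω)) := measurable_infDist
  have m1 : Measurable f1 := Measurable.indicator (by fun_prop) hmS
  have m2 : Measurable f2 := Measurable.indicator (by fun_prop) hmR
  have m3 : Measurable f3 := Measurable.indicator (by fun_prop) hmI
  calc ∫⁻ w in EE Ω e a, pw ‖w - a‖ (2 + α) * pw (infDist w (frontier Ω)) η
      ≤ ∫⁻ w in EE Ω e a, (f1 w + f2 w + (1 + P) * f3 w) := by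
        apply setLIntegral_mono' (measurableSet_EE hΩo e a)
        intro w hw
        have hd : infDist w (frontier Ω) ≤ ‖w - a‖ := by
          rw [← dist_eq_norm]; exact infDist_le_dist_of_mem ha
        by_cases hwa : ‖w - a‖ < 1 / N
        · have hst := EE_strip hN hF hw hwa
          have hd1 : infDist w (frontier Ω) ≤ 1 := hd.trans hst.1
          rw [hf1, hf3, indicator_of_mem hst, indicator_of_mem (show w ∈ {w : ℂ | infDist w (frontier Ω) ≤ 1} from hd1)]
          refine (pw_young (by linarith) (by linarith) hη (by norm_num) hηc _ _).trans ?_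
          apply add_le_add le_self_add
          exact le_mul_of_one_le_left zero_le le_self_add
        · have hR : 1 / N ≤ ‖w - a‖ := not_lt.1 hwa
          rw [hf2, indicator_of_mem (show w ∈ {w : ℂ | 1 / N ≤ ‖w - a‖} from hR)]
          by_cases hd1 : infDist w (frontier Ω) ≤ 1
          · rw [hf3, indicator_of_mem (show w ∈ {w : ℂ | infDist w (frontier Ω) ≤ 1} from hd1)]
            refine le_trans ?_ le_add_self
            apply mul_le_mul' _ (pw_exp hd1 hη1)
            exact (pw_anti (by linarith) hR).trans le_add_self
          · refine le_trans ?_ (le_self_add.trans' le_add_self)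
            exact mul_le_of_le_one_right zero_le (pw_le_one hη.le (le_of_lt (not_le.1 hd1)))
    _ ≤ ∫⁻ w, (f1 w + f2 w + (1 + P) * f3 w) := setLIntegral_le_lintegral _ _
    _ = (∫⁻ w, f1 w) + (∫⁻ w, f2 w) + (1 + P) * ∫⁻ w, f3 w := by
        have m12 : Measurable (fun w => f1 w + f2 w) := m1.add m2
        rw [lintegral_add_left m12, lintegral_add_left m1, lintegral_const_mul _ m3]
    _ ≤ _ := by
        rw [hf1, hf2, hf3, lintegral_indicator hmS, lintegral_indicator hmR, lintegral_indicator hmI]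
        gcongr
        · exact H1 e a he
        · exact H2 a

theorem J2 {Ω : Set ℂ} (hΩo : IsOpen Ω) {α ε N η D : ℝ} (hα : 0 < α) (hαε : α < ε) (hε1 : ε < 1) (hN : 1 ≤ N)
    (hη : 0 < η) (hη1 : η ≤ 1/2) (hηc : (2 + α) / (2 + (α + ε) / 2) + η / (1/2) = 1)
    (hD : ∀ a ∈ frontier Ω, Ω ⊆ closedBall a D) :
    ∃ C < ⊤, ∀ a ∈ frontier Ω, ∀ e, ‖e‖ = 1 → FlatE Ω ε N a e →
      ∫⁻ w in Ω ∩ HP e a, pw ‖w - a‖ (2 + α) * pw (e * (w - a)).im η ≤ C := by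
  obtain ⟨C1, hC1, H1⟩ := strip_int (β := (α + ε) / 2) (ε := ε) (N := N) (by linarith) (by linarith) hε1 hN
  obtain ⟨C2, hC2, H2⟩ := lint_tail (2 + α) (1 / N) (by linarith) (by positivity)
  obtain ⟨I, hI, H3⟩ := lint_box 0 (1/2) D le_rfl (by norm_num) (by norm_num) (by norm_num)
  set P := pw (1 / N) (2 + α) with hP
  have hPt : P ≠ ⊤ := pw_ne_top (by positivity) _
  refine ⟨C1 + C2 + (1 + P) * I, ENNReal.add_lt_top.2 ⟨ENNReal.add_lt_top.2 ⟨hC1, hC2⟩,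
    ENNReal.mul_lt_top (ENNReal.add_lt_top.2 ⟨by simp, lt_top_iff_ne_top.2 hPt⟩) hI⟩, fun a ha e he hF => ?_⟩
  have hmS := measurableSet_strip ε N e a
  have hmR : MeasurableSet {w : ℂ | 1 / N ≤ ‖w - a‖} := measurableSet_le measurable_const (by fun_prop)
  set f1 := (strip ε N e a).indicator (fun w => pw ‖w - a‖ (2 + (α + ε) / 2)) with hf1
  set f2 := {w : ℂ | 1 / N ≤ ‖w - a‖}.indicator (fun w => pw ‖w - a‖ (2 + α)) with hf2
  set f3 := (closedBall a D).indicator (fun w => pw |(e * (w - a)).re| 0 * pw |(e * (w - a)).im| (1/2)) with hf3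
  have m1 : Measurable f1 := Measurable.indicator (by fun_prop) hmS
  have m2 : Measurable f2 := Measurable.indicator (by fun_prop) hmR
  have m3 : Measurable f3 := Measurable.indicator (by fun_prop) measurableSet_closedBall
  calc ∫⁻ w in Ω ∩ HP e a, pw ‖w - a‖ (2 + α) * pw (e * (w - a)).im η
      ≤ ∫⁻ w in Ω ∩ HP e a, (f1 w + f2 w + (1 + P) * f3 w) := by
        apply setLIntegral_mono' (hΩo.measurableSet.inter (isOpen_HP e a).measurableSet)
        intro w hw
        have hy : 0 < (e * (w - a)).im := hw.2
        rw [hf3, indicator_of_mem (hD a ha hw.1), pw_zero, one_mul, abs_of_pos hy]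
        by_cases hwa : ‖w - a‖ < 1 / N
        · have hst := EE_strip hN hF (Or.inr hw) hwa
          rw [hf1, indicator_of_mem hst]
          refine (pw_young (by linarith) (by linarith) hη (by norm_num) hηc _ _).trans ?_
          apply add_le_add le_self_add
          exact le_mul_of_one_le_left zero_le le_self_add
        · have hR : 1 / N ≤ ‖w - a‖ := not_lt.1 hwa
          rw [hf2, indicator_of_mem (show w ∈ {w : ℂ | 1 / N ≤ ‖w - a‖} from hR)]
          by_cases hd1 : (e * (w - a)).im ≤ 1
          · refine le_trans ?_ le_add_self
            apply mul_le_mul' _ (pw_exp hd1 hη1)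
            exact (pw_anti (by linarith) hR).trans le_add_self
          · refine le_trans ?_ (le_self_add.trans' le_add_self)
            exact mul_le_of_le_one_right zero_le (pw_le_one hη.le (le_of_lt (not_le.1 hd1)))
    _ ≤ ∫⁻ w, (f1 w + f2 w + (1 + P) * f3 w) := setLIntegral_le_lintegral _ _
    _ = (∫⁻ w, f1 w) + (∫⁻ w, f2 w) + (1 + P) * ∫⁻ w, f3 w := by
        have m12 : Measurable (fun w => f1 w + f2 w) := m1.add m2
        rw [lintegral_add_left m12, lintegral_add_left m1, lintegral_const_mul _ m3]
    _ ≤ _ := by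
        rw [hf1, hf2, hf3, lintegral_indicator hmS, lintegral_indicator hmR, lintegral_indicator measurableSet_closedBall]
        gcongr
        · exact H1 e a he
        · exact H2 a
        · exact H3 e a he



theorem cross_frontier {Ω : Set ℂ} (hΩo : IsOpen Ω) {ζ w : ℂ} (hζ : ζ ∈ Ω) (hw : w ∉ Ω) :
    ∃ p ∈ frontier Ω, dist ζ p + dist p w = dist ζ w := by
  by_contra hcon
  push Not at hcon
  have hd : ∀ p ∈ segment ℝ ζ w, p ∉ frontier Ω := fun p hp hpf =>
    hcon p hpf (dist_add_dist_of_mem_segment hp)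
  have hpc := (convex_segment (𝕜 := ℝ) ζ w).isPreconnected
  have hsub : segment ℝ ζ w ⊆ Ω ∪ (closure Ω)ᶜ := by
    intro p hp
    by_cases h : p ∈ Ω
    · exact Or.inl h
    · right
      intro hc
      apply hd p hp
      rw [hΩo.frontier_eq]
      exact ⟨hc, h⟩
  have hwc : w ∈ (closure Ω)ᶜ := by
    rcases hsub (right_mem_segment ℝ ζ w) with h | h
    · exact absurd h hw
    · exact h
  obtain ⟨p, hp1, hp2, hp3⟩ := hpc Ω (closure Ω)ᶜ hΩo isClosed_closure.isOpen_compl hsub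
    ⟨ζ, left_mem_segment ℝ ζ w, hζ⟩ ⟨w, right_mem_segment ℝ ζ w, hwc⟩
  exact hp3 (subset_closure hp2)

theorem dist_le_left {Ω : Set ℂ} (hΩo : IsOpen Ω) {ζ w : ℂ} (hζ : ζ ∈ Ω) (hw : w ∉ Ω) :
    infDist ζ (frontier Ω) ≤ ‖w - ζ‖ := by
  obtain ⟨p, hp, h⟩ := cross_frontier hΩo hζ hw
  have h1 := infDist_le_dist_of_mem (x := ζ) hp
  have h2 := dist_nonneg (x := p) (y := w)
  rw [← dist_eq_norm, dist_comm w ζ]; linarith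

theorem dist_le_right {Ω : Set ℂ} (hΩo : IsOpen Ω) {ζ w : ℂ} (hζ : ζ ∈ Ω) (hw : w ∉ Ω) :
    infDist w (frontier Ω) ≤ ‖w - ζ‖ := by
  obtain ⟨p, hp, h⟩ := cross_frontier hΩo hζ hw
  have h1 := infDist_le_dist_of_mem (x := w) hp
  have h2 := dist_nonneg (x := ζ) (y := p)
  rw [dist_comm w p] at h1
  rw [← dist_eq_norm, dist_comm w ζ]; linarith

theorem conv_bound {α η D : ℝ} (hα : 0 < α) (hη : 0 < η) (hηα : η ≤ 1 - α) (hD : 0 < D) :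
    ∃ C < ⊤, ∀ a ζ : ℂ, ζ ≠ a → ‖ζ - a‖ ≤ D →
      ∫⁻ w, pw ‖w - a‖ (1 + α) * pw ‖w - ζ‖ (2 - η) ≤ C * pw ‖ζ - a‖ (1 + α) := by
  obtain ⟨C1, hC1, H1⟩ := lint_riesz (2 - η) (3 * D) (by linarith) (by linarith)
  obtain ⟨C2, hC2, H2⟩ := lint_tail (3 + α - η) (2 * D) (by linarith) (by linarith)
  set P := pw (1/2) (1 + α) with hP
  set Q := (pw D (1 + α))⁻¹ * pw (1/2) (2 - η) with hQ
  have hPt : P < ⊤ := lt_top_iff_ne_top.2 (pw_ne_top (by norm_num) _)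
  have hQt : Q < ⊤ := ENNReal.mul_lt_top (ENNReal.inv_lt_top.2 (pos_iff_ne_zero.2 (pw_ne_zero _ (by linarith))))
    (lt_top_iff_ne_top.2 (pw_ne_top (by norm_num) _))
  refine ⟨P * C1 + P * C1 + Q * C2, ENNReal.add_lt_top.2 ⟨ENNReal.add_lt_top.2 ⟨ENNReal.mul_lt_top hPt hC1,
    ENNReal.mul_lt_top hPt hC1⟩, ENNReal.mul_lt_top hQt hC2⟩, fun a ζ hne hζ => ?_⟩
  set R := ‖ζ - a‖ with hR
  have hR0 : 0 < R := norm_pos_iff.2 (sub_ne_zero.2 hne)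
  have hmR : MeasurableSet {w : ℂ | 2 * D ≤ ‖w - a‖} := measurableSet_le measurable_const (by fun_prop)
  set f1 := (closedBall a (3 * D)).indicator (fun w => pw ‖w - a‖ (2 - η)) with hf1
  set f2 := (closedBall ζ (3 * D)).indicator (fun w => pw ‖w - ζ‖ (2 - η)) with hf2
  set f3 := {w : ℂ | 2 * D ≤ ‖w - a‖}.indicator (fun w => pw ‖w - a‖ (3 + α - η)) with hf3
  have m1 : Measurable f1 := Measurable.indicator (by fun_prop) measurableSet_closedBall
  have m2 : Measurable f2 := Measurable.indicator (by fun_prop) measurableSet_closedBall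
  have m3 : Measurable f3 := Measurable.indicator (by fun_prop) hmR
  set X := pw R (1 + α) with hX
  have hX2 : pw (R / 2) (1 + α) = P * X := by
    rw [show R / 2 = 1/2 * R by ring, pw_mul_left (by norm_num) _ _ (by linarith)]
  calc ∫⁻ w, pw ‖w - a‖ (1 + α) * pw ‖w - ζ‖ (2 - η)
      ≤ ∫⁻ w, (P * X * f1 w + P * X * f2 w + Q * X * f3 w) := by
        apply lintegral_mono
        intro w
        beta_reduce
        have t1 : R ≤ ‖w - a‖ + ‖w - ζ‖ := by
          rw [hR, ← dist_eq_norm, ← dist_eq_norm, ← dist_eq_norm]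
          have := dist_triangle ζ w a
          rw [dist_comm ζ w] at this; linarith
        by_cases hw : 2 * D ≤ ‖w - a‖
        · refine le_trans ?_ le_add_self
          rw [hf3, indicator_of_mem (show w ∈ {w : ℂ | 2 * D ≤ ‖w - a‖} from hw)]
          have t2 : 1/2 * ‖w - a‖ ≤ ‖w - ζ‖ := by
            have := norm_sub_le_norm_sub_add_norm_sub w ζ a
            rw [← hR] at this; linarith
          have t3 := pw_anti (s := 2 - η) (by linarith) t2
          rw [pw_mul_left (by norm_num) _ _ (by linarith)] at t3
          have t4 : 1 ≤ (pw D (1 + α))⁻¹ * X := by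
            rw [mul_comm, ← div_eq_mul_inv, ENNReal.le_div_iff_mul_le (Or.inl (pw_ne_zero _ (by linarith))) (Or.inl (pw_ne_top hD _)), one_mul]
            exact pw_anti (by linarith) hζ
          have t5 : pw ‖w - a‖ (3 + α - η) = pw ‖w - a‖ (1 + α) * pw ‖w - a‖ (2 - η) := by
            rw [← pw_add _ (by linarith) (by linarith)]; congr 1; ring
          rw [t5]
          calc pw ‖w - a‖ (1 + α) * pw ‖w - ζ‖ (2 - η) ≤ pw ‖w - a‖ (1 + α) * (pw (1/2) (2 - η) * pw ‖w - a‖ (2 - η)) := by gcongr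
            _ ≤ ((pw D (1 + α))⁻¹ * X) * (pw ‖w - a‖ (1 + α) * (pw (1/2) (2 - η) * pw ‖w - a‖ (2 - η))) :=
                le_mul_of_one_le_left zero_le t4
            _ = _ := by rw [hQ]; ring
        · push Not at hw
          refine le_trans ?_ le_self_add
          have w1 : w ∈ closedBall a (3 * D) := by rw [mem_closedBall, dist_eq_norm]; linarith
          have w2 : w ∈ closedBall ζ (3 * D) := by
            rw [mem_closedBall, dist_eq_norm]
            have := norm_sub_le_norm_sub_add_norm_sub w a ζ
            rw [norm_sub_rev a ζ, ← hR] at this; linarith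
          rw [hf1, hf2, indicator_of_mem w1, indicator_of_mem w2, ← hX2]
          by_cases hc : R / 2 ≤ ‖w - a‖
          · refine le_trans ?_ le_add_self
            gcongr
            exact pw_anti (by linarith) hc
          · refine le_trans ?_ le_self_add
            have t2 : R / 2 ≤ ‖w - ζ‖ := by linarith
            have t6 : ‖w - a‖ ≤ ‖w - ζ‖ := by linarith
            have t5 : ∀ x, pw x (2 - η) = pw x (1 + α) * pw x (1 - α - η) := by
              intro x
              rw [← pw_add _ (by linarith) (by linarith)]; congr 1; ring
            rw [t5, t5]
            calc pw ‖w - a‖ (1 + α) * (pw ‖w - ζ‖ (1 + α) * pw ‖w - ζ‖ (1 - α - η)) ≤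
                  pw ‖w - a‖ (1 + α) * (pw (R / 2) (1 + α) * pw ‖w - a‖ (1 - α - η)) := by
                  gcongr
                  · exact pw_anti (by linarith) t2
                  · exact pw_anti (by linarith) t6
              _ = _ := by ring
    _ = P * X * (∫⁻ w, f1 w) + P * X * (∫⁻ w, f2 w) + Q * X * ∫⁻ w, f3 w := by
        have k1 : Measurable (fun w => P * X * f1 w) := m1.const_mul _
        have k2 : Measurable (fun w => P * X * f1 w + P * X * f2 w) := k1.add (m2.const_mul _)
        rw [lintegral_add_left k2, lintegral_add_left k1, lintegral_const_mul _ m3, lintegral_const_mul _ m1, lintegral_const_mul _ m2]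
    _ ≤ P * X * C1 + P * X * C1 + Q * X * C2 := by
        rw [hf1, hf2, hf3, lintegral_indicator measurableSet_closedBall, lintegral_indicator measurableSet_closedBall, lintegral_indicator hmR]
        gcongr
        · exact H1 a
        · exact H1 ζ
        · exact H2 a
    _ = _ := by ring

open Classical in
/-- the sum of the three terms in the bound for the kernel -/
def TT (Ω : Set ℂ) (α η : ℝ) (e a ζ : ℂ) : ℝ≥0∞ :=
  ((∫⁻ w in Ωᶜ \ HP e a, pw ‖w - a‖ (2 + α) * pw ‖w - ζ‖ 2) +
       (∫⁻ w in Ω ∩ HP e a, pw ‖w - a‖ (2 + α) * (pw (e * (w - a)).im η * pw ‖w - ζ‖ (2 - η))) +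
       (if ζ ∈ HP e a then ∫⁻ w in Ωᶜ, pw ‖ζ - a‖ 1 * (pw ‖w - a‖ (1 + α) * pw ‖w - ζ‖ 2) else 0))

theorem pw_split {η x y : ℝ} (h0 : 0 ≤ η) (h2 : η ≤ 2) (h : y ≤ x) : pw x 2 ≤ pw y η * pw x (2 - η) := by
  have : pw x 2 = pw x η * pw x (2 - η) := by
    rw [← pw_add _ h0 (by linarith)]; congr 1; ring
  rw [this]
  gcongr
  exact pw_anti h0 h

theorem TT_int {Ω : Set ℂ} (hΩo : IsOpen Ω) (hvol : volume Ω < ⊤) {α ε N η D : ℝ} (hα : 0 < α) (hαε : α < ε) (hε1 : ε < 1) (hN : 1 ≤ N)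
    (hη : 0 < η) (hη1 : η ≤ 1/2) (hηα : η ≤ 1 - α) (hηc : (2 + α) / (2 + (α + ε) / 2) + η / (1/2) = 1)
    (hI : ∫⁻ w in {w | infDist w (frontier Ω) ≤ 1}, pw (infDist w (frontier Ω)) (1/2) < ⊤)
    (hD0 : 0 < D) (hD : ∀ a ∈ frontier Ω, Ω ⊆ closedBall a D) :
    ∃ C < ⊤, ∀ a ∈ frontier Ω, ∀ e, ‖e‖ = 1 → FlatE Ω ε N a e → ∫⁻ ζ in Ω, TT Ω α η e a ζ ≤ C := by
  obtain ⟨C1, hC1, H1⟩ := J1 hΩo hα hαε hε1 hN hη hη1 hηc hI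
  obtain ⟨C2, hC2, H2⟩ := J2 hΩo hα hαε hε1 hN hη hη1 hηc hD
  obtain ⟨C3, hC3, H3⟩ := lint_riesz_set (2 - η) (by linarith) (by linarith) Ω hvol
  obtain ⟨C4, hC4, H4⟩ := conv_bound hα hη hηα hD0
  have hO := hΩo.measurableSet
  refine ⟨C3 * C1 + C3 * C2 + C4 * C1, ENNReal.add_lt_top.2 ⟨ENNReal.add_lt_top.2 ⟨ENNReal.mul_lt_top hC3 hC1,
    ENNReal.mul_lt_top hC3 hC2⟩, ENNReal.mul_lt_top hC4 hC1⟩, fun a ha e he hF => ?_⟩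
  have hH := (isOpen_HP e a).measurableSet
  have haΩ : a ∉ Ω := by
    rw [hΩo.frontier_eq] at ha; exact ha.2
  have md : Measurable (fun w : ℂ => infDist w (frontier Ω)) := measurable_infDist
  have riesz : ∀ w, ∫⁻ ζ in Ω, pw ‖w - ζ‖ (2 - η) ≤ C3 := by
    intro w
    refine le_trans (le_of_eq ?_) (H3 w)
    congr 1; ext ζ; rw [norm_sub_rev]
  have mA : Measurable (fun p : ℂ × ℂ => pw ‖p.2 - a‖ (2 + α) * pw ‖p.2 - p.1‖ 2) := by fun_prop
  have mB : Measurable (fun p : ℂ × ℂ => pw ‖p.2 - a‖ (2 + α) * (pw (e * (p.2 - a)).im η * pw ‖p.2 - p.1‖ (2 - η))) := by fun_prop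
  have A : ∫⁻ ζ in Ω, ∫⁻ w in Ωᶜ \ HP e a, pw ‖w - a‖ (2 + α) * pw ‖w - ζ‖ 2 ≤ C3 * C1 := by
    rw [lintegral_lintegral_swap mA.aemeasurable]
    calc ∫⁻ w in Ωᶜ \ HP e a, ∫⁻ ζ in Ω, pw ‖w - a‖ (2 + α) * pw ‖w - ζ‖ 2
        ≤ ∫⁻ w in Ωᶜ \ HP e a, C3 * (pw ‖w - a‖ (2 + α) * pw (infDist w (frontier Ω)) η) := by
          apply setLIntegral_mono' (hO.compl.diff hH)
          intro w hw
          rw [lintegral_const_mul _ (by fun_prop)]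
          calc pw ‖w - a‖ (2 + α) * ∫⁻ ζ in Ω, pw ‖w - ζ‖ 2
              ≤ pw ‖w - a‖ (2 + α) * ∫⁻ ζ in Ω, pw (infDist w (frontier Ω)) η * pw ‖w - ζ‖ (2 - η) := by
                refine mul_le_mul_right ?_ _
                apply setLIntegral_mono' hO
                intro ζ hζ
                exact pw_split hη.le (by linarith) (dist_le_right hΩo hζ hw.1)
            _ = pw ‖w - a‖ (2 + α) * (pw (infDist w (frontier Ω)) η * ∫⁻ ζ in Ω, pw ‖w - ζ‖ (2 - η)) := by
                rw [lintegral_const_mul _ (by fun_prop)]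
            _ ≤ pw ‖w - a‖ (2 + α) * (pw (infDist w (frontier Ω)) η * C3) := by
                gcongr; exact riesz w
            _ = _ := by ring
      _ = C3 * ∫⁻ w in Ωᶜ \ HP e a, (pw ‖w - a‖ (2 + α) * pw (infDist w (frontier Ω)) η) := by
          rw [lintegral_const_mul _ (by fun_prop)]
      _ ≤ C3 * C1 := by
          gcongr
          exact (lintegral_mono_set subset_union_left).trans (H1 a ha e he hF)
  have B : ∫⁻ ζ in Ω, ∫⁻ w in Ω ∩ HP e a, pw ‖w - a‖ (2 + α) * (pw (e * (w - a)).im η * pw ‖w - ζ‖ (2 - η)) ≤ C3 * C2 := by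
    rw [lintegral_lintegral_swap mB.aemeasurable]
    calc ∫⁻ w in Ω ∩ HP e a, ∫⁻ ζ in Ω, pw ‖w - a‖ (2 + α) * (pw (e * (w - a)).im η * pw ‖w - ζ‖ (2 - η))
        ≤ ∫⁻ w in Ω ∩ HP e a, C3 * (pw ‖w - a‖ (2 + α) * pw (e * (w - a)).im η) := by
          apply setLIntegral_mono' (hO.inter hH)
          intro w hw
          rw [lintegral_const_mul _ (by fun_prop), lintegral_const_mul _ (by fun_prop)]
          calc pw ‖w - a‖ (2 + α) * (pw (e * (w - a)).im η * ∫⁻ ζ in Ω, pw ‖w - ζ‖ (2 - η))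
              ≤ pw ‖w - a‖ (2 + α) * (pw (e * (w - a)).im η * C3) := by
                gcongr; exact riesz w
            _ = _ := by ring
      _ = C3 * ∫⁻ w in Ω ∩ HP e a, (pw ‖w - a‖ (2 + α) * pw (e * (w - a)).im η) := by
          rw [lintegral_const_mul _ (by fun_prop)]
      _ ≤ C3 * C2 := by
          gcongr
          exact H2 a ha e he hF
  classical
  have Cc : ∫⁻ ζ in Ω, (if ζ ∈ HP e a then ∫⁻ w in Ωᶜ, pw ‖ζ - a‖ 1 * (pw ‖w - a‖ (1 + α) * pw ‖w - ζ‖ 2) else 0) ≤ C4 * C1 := by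
    calc ∫⁻ ζ in Ω, (if ζ ∈ HP e a then ∫⁻ w in Ωᶜ, pw ‖ζ - a‖ 1 * (pw ‖w - a‖ (1 + α) * pw ‖w - ζ‖ 2) else 0)
        ≤ ∫⁻ ζ in Ω, (HP e a).indicator (fun ζ => C4 * (pw ‖ζ - a‖ (2 + α) * pw (infDist ζ (frontier Ω)) η)) ζ := by
          apply setLIntegral_mono' hO
          intro ζ hζ
          by_cases h : ζ ∈ HP e a
          · rw [if_pos h, indicator_of_mem h, lintegral_const_mul _ (by fun_prop)]
            have hne : ζ ≠ a := fun h => haΩ (h ▸ hζ)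
            have hDζ : ‖ζ - a‖ ≤ D := by rw [← dist_eq_norm]; exact hD a ha hζ
            calc pw ‖ζ - a‖ 1 * ∫⁻ w in Ωᶜ, pw ‖w - a‖ (1 + α) * pw ‖w - ζ‖ 2
                ≤ pw ‖ζ - a‖ 1 * ∫⁻ w in Ωᶜ, pw (infDist ζ (frontier Ω)) η * (pw ‖w - a‖ (1 + α) * pw ‖w - ζ‖ (2 - η)) := by
                  refine mul_le_mul_right ?_ _
                  apply setLIntegral_mono' hO.compl
                  intro w hw
                  refine (mul_le_mul_right (pw_split hη.le (by linarith) (dist_le_left hΩo hζ hw)) _).trans (le_of_eq ?_)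
                  ring
              _ ≤ pw ‖ζ - a‖ 1 * (pw (infDist ζ (frontier Ω)) η * (C4 * pw ‖ζ - a‖ (1 + α))) := by
                  rw [lintegral_const_mul _ (by fun_prop)]
                  gcongr
                  exact (setLIntegral_le_lintegral _ _).trans (H4 a ζ hne hDζ)
              _ = C4 * ((pw ‖ζ - a‖ 1 * pw ‖ζ - a‖ (1 + α)) * pw (infDist ζ (frontier Ω)) η) := by ring
              _ = _ := by
                  rw [← pw_add _ (by linarith) (by linarith), show 1 + (1 + α) = 2 + α by ring]
          · rw [if_neg h]; exact zero_le
      _ = ∫⁻ ζ in HP e a ∩ Ω, C4 * (pw ‖ζ - a‖ (2 + α) * pw (infDist ζ (frontier Ω)) η) := by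
          rw [lintegral_indicator hH, Measure.restrict_restrict hH]
      _ = C4 * ∫⁻ ζ in HP e a ∩ Ω, (pw ‖ζ - a‖ (2 + α) * pw (infDist ζ (frontier Ω)) η) := by
          rw [lintegral_const_mul _ (by fun_prop)]
      _ ≤ C4 * C1 := by
          gcongr
          rw [inter_comm]
          exact (lintegral_mono_set subset_union_right).trans (H1 a ha e he hF)
  have k1 : Measurable (fun ζ => ∫⁻ w in Ωᶜ \ HP e a, pw ‖w - a‖ (2 + α) * pw ‖w - ζ‖ 2) := mA.lintegral_prod_right'
  have k2 : Measurable (fun ζ => ∫⁻ w in Ω ∩ HP e a, pw ‖w - a‖ (2 + α) * (pw (e * (w - a)).im η * pw ‖w - ζ‖ (2 - η))) :=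
    mB.lintegral_prod_right'
  have k12 : Measurable (fun ζ => (∫⁻ w in Ωᶜ \ HP e a, pw ‖w - a‖ (2 + α) * pw ‖w - ζ‖ 2) +
    (∫⁻ w in Ω ∩ HP e a, pw ‖w - a‖ (2 + α) * (pw (e * (w - a)).im η * pw ‖w - ζ‖ (2 - η)))) := k1.add k2
  have goal : ∫⁻ ζ in Ω, TT Ω α η e a ζ = (∫⁻ ζ in Ω, ∫⁻ w in Ωᶜ \ HP e a, pw ‖w - a‖ (2 + α) * pw ‖w - ζ‖ 2) +
    (∫⁻ ζ in Ω, ∫⁻ w in Ω ∩ HP e a, pw ‖w - a‖ (2 + α) * (pw (e * (w - a)).im η * pw ‖w - ζ‖ (2 - η))) +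
    ∫⁻ ζ in Ω, (if ζ ∈ HP e a then ∫⁻ w in Ωᶜ, pw ‖ζ - a‖ 1 * (pw ‖w - a‖ (1 + α) * pw ‖w - ζ‖ 2) else 0) := by
    unfold TT
    rw [lintegral_add_left k12, lintegral_add_left k1]
  rw [goal]
  exact add_le_add (add_le_add A B) Cc



theorem line_null (e a : ℂ) (he : ‖e‖ = 1) : ∀ᵐ ζ : ℂ, (e * (ζ - a)).im ≠ 0 := by
  have hm : MeasurableSet {u : ℂ | u.im = 0} := measurableSet_eq_fun Complex.measurable_im measurable_const
  have hm' : MeasurableSet {ζ : ℂ | (e * (ζ - a)).im = 0} := measurableSet_eq_fun (by fun_prop) measurable_const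
  have h1 := lint_rot e a he ({u : ℂ | u.im = 0}.indicator 1)
  have h2 : ∫⁻ u, ({u : ℂ | u.im = 0}.indicator (1 : ℂ → ℝ≥0∞)) u = 0 := by
    rw [lint_prod _ (measurable_one.indicator hm)]
    have : ∀ x : ℝ, ∫⁻ y : ℝ, ({u : ℂ | u.im = 0}.indicator (1 : ℂ → ℝ≥0∞)) ⟨x, y⟩ = 0 := by
      intro x
      have : (fun y : ℝ => ({u : ℂ | u.im = 0}.indicator (1 : ℂ → ℝ≥0∞)) ⟨x, y⟩) = ({0} : Set ℝ).indicator 1 := by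
        ext y
        simp [indicator]
      rw [this, lintegral_indicator_one (measurableSet_singleton _)]
      simp
    simp [this]
  rw [h2] at h1
  have h3 : ∫⁻ w, ({ζ : ℂ | (e * (ζ - a)).im = 0}.indicator (1 : ℂ → ℝ≥0∞)) w = 0 := by
    rw [← h1]; rfl
  rw [lintegral_indicator_one hm'] at h3
  rw [ae_iff]
  simpa using h3

/-- the diagonal double integral -/
def XX (Ω : Set ℂ) (z : ℂ) : ℝ≥0∞ := ∫⁻ ζ in Ω, ∫⁻ w in Ωᶜ, pw ‖w - z‖ 2 * pw ‖w - ζ‖ 2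

theorem XX_bound {Ω : Set ℂ} (hΩo : IsOpen Ω) (hΩb : Bornology.IsBounded Ω) (hfne : (frontier Ω).Nonempty)
    {η D h1 : ℝ} (hη : 0 < η) (hη1 : η ≤ 1/2)
    (hI : ∫⁻ w in {w | infDist w (frontier Ω) ≤ 1}, pw (infDist w (frontier Ω)) (1/2) < ⊤)
    (hD0 : 0 < D) (hD : ∀ a ∈ frontier Ω, Ω ⊆ closedBall a D) (hh1 : 0 < h1) :
    ∃ C < ⊤, ∀ z ∈ Ω, h1 ≤ infDist z (frontier Ω) → XX Ω z ≤ C := by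
  have hvol : volume Ω < ⊤ := hΩb.measure_lt_top
  obtain ⟨C3, hC3, H3⟩ := lint_riesz_set (2 - η) (by linarith) (by linarith) Ω hvol
  obtain ⟨C2, hC2, H2⟩ := lint_tail 4 h1 (by norm_num) hh1
  have hO := hΩo.measurableSet
  set I := ∫⁻ w in {w | infDist w (frontier Ω) ≤ 1}, pw (infDist w (frontier Ω)) (1/2) with hI'
  set P := pw h1 2 * C3 with hP
  set Q := volume Ω * pw (1 / (1 + D)) 2 with hQ
  have hPt : P < ⊤ := ENNReal.mul_lt_top (lt_top_iff_ne_top.2 (pw_ne_top hh1 _)) hC3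
  have hQt : Q < ⊤ := ENNReal.mul_lt_top hvol (lt_top_iff_ne_top.2 (pw_ne_top (by positivity) _))
  refine ⟨P * I + Q * C2, ENNReal.add_lt_top.2 ⟨ENNReal.mul_lt_top hPt hI, ENNReal.mul_lt_top hQt hC2⟩, fun z hz hzh => ?_⟩
  have md : Measurable (fun w : ℂ => infDist w (frontier Ω)) := measurable_infDist
  have riesz : ∀ w, ∫⁻ ζ in Ω, pw ‖w - ζ‖ (2 - η) ≤ C3 := by
    intro w
    refine le_trans (le_of_eq ?_) (H3 w)
    congr 1; ext ζ; rw [norm_sub_rev]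
  have mA : Measurable (fun p : ℂ × ℂ => pw ‖p.2 - z‖ 2 * pw ‖p.2 - p.1‖ 2) := by fun_prop
  have hmI : MeasurableSet {w : ℂ | infDist w (frontier Ω) ≤ 1} := measurableSet_le (measurable_infDist) measurable_const
  have hmR : MeasurableSet {w : ℂ | h1 ≤ ‖w - z‖} := measurableSet_le measurable_const (by fun_prop)
  set f1 := {w : ℂ | infDist w (frontier Ω) ≤ 1}.indicator (fun w => pw (infDist w (frontier Ω)) (1/2)) with hf1
  set f2 := {w : ℂ | h1 ≤ ‖w - z‖}.indicator (fun w => pw ‖w - z‖ 4) with hf2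
  have m1 : Measurable f1 := Measurable.indicator (by fun_prop) hmI
  have m2 : Measurable f2 := Measurable.indicator (by fun_prop) hmR
  unfold XX
  rw [lintegral_lintegral_swap mA.aemeasurable]
  calc ∫⁻ w in Ωᶜ, ∫⁻ ζ in Ω, pw ‖w - z‖ 2 * pw ‖w - ζ‖ 2
      ≤ ∫⁻ w in Ωᶜ, (P * f1 w + Q * f2 w) := by
        apply setLIntegral_mono' hO.compl
        intro w hw
        rw [lintegral_const_mul _ (by fun_prop)]
        have hwz : h1 ≤ ‖w - z‖ := hzh.trans (dist_le_left hΩo hz hw)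
        by_cases hd1 : infDist w (frontier Ω) ≤ 1
        · refine le_trans ?_ le_self_add
          rw [hf1, indicator_of_mem (show w ∈ {w : ℂ | infDist w (frontier Ω) ≤ 1} from hd1), hP, mul_assoc]
          apply mul_le_mul' (pw_anti (by norm_num) hwz)
          calc ∫⁻ ζ in Ω, pw ‖w - ζ‖ 2
              ≤ ∫⁻ ζ in Ω, pw (infDist w (frontier Ω)) η * pw ‖w - ζ‖ (2 - η) := by
                apply setLIntegral_mono' hO
                intro ζ hζ
                exact pw_split hη.le (by linarith) (dist_le_right hΩo hζ hw)
            _ = pw (infDist w (frontier Ω)) η * ∫⁻ ζ in Ω, pw ‖w - ζ‖ (2 - η) := by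
                rw [lintegral_const_mul _ (by fun_prop)]
            _ ≤ pw (infDist w (frontier Ω)) (1/2) * C3 := by
                apply mul_le_mul' (pw_exp hd1 hη1) (riesz w)
            _ = _ := by ring
        · push Not at hd1
          refine le_trans ?_ le_add_self
          rw [hf2, indicator_of_mem (show w ∈ {w : ℂ | h1 ≤ ‖w - z‖} from hwz), hQ]
          obtain ⟨b, hb, hbd⟩ := (frontier_compact hΩb).exists_infDist_eq_dist hfne w
          have hzb : dist z b ≤ D := hD b hb hz
          have k1 : 1 / (1 + D) * ‖w - z‖ ≤ infDist w (frontier Ω) := by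
            have := dist_triangle w b z
            rw [dist_comm b z, ← hbd, dist_eq_norm w z] at this
            rw [one_div, inv_mul_le_iff₀ (by linarith)]
            nlinarith
          have k2 : ∫⁻ ζ in Ω, pw ‖w - ζ‖ 2 ≤ (pw (1 / (1 + D)) 2 * pw ‖w - z‖ 2) * volume Ω := by
            rw [← setLIntegral_const, ← pw_mul_left (by positivity) _ _ (by norm_num)]
            apply setLIntegral_mono' hO
            intro ζ hζ
            exact pw_anti (by norm_num) (k1.trans (dist_le_right hΩo hζ hw))
          calc pw ‖w - z‖ 2 * ∫⁻ ζ in Ω, pw ‖w - ζ‖ 2 ≤ pw ‖w - z‖ 2 * ((pw (1 / (1 + D)) 2 * pw ‖w - z‖ 2) * volume Ω) := by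
                gcongr
            _ = volume Ω * pw (1 / (1 + D)) 2 * (pw ‖w - z‖ 2 * pw ‖w - z‖ 2) := by ring
            _ = _ := by
                rw [← pw_add _ (by norm_num) (by norm_num)]; norm_num
    _ ≤ ∫⁻ w, (P * f1 w + Q * f2 w) := setLIntegral_le_lintegral _ _
    _ = P * (∫⁻ w, f1 w) + Q * ∫⁻ w, f2 w := by
        have k1 : Measurable (fun w => P * f1 w) := m1.const_mul _
        rw [lintegral_add_left k1, lintegral_const_mul _ m1, lintegral_const_mul _ m2]
    _ ≤ _ := by
        rw [hf1, hf2, lintegral_indicator hmI, lintegral_indicator hmR]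
        gcongr
        exact H2 z

theorem inv_sq_enorm {u : ℂ} (hu : u ≠ 0) : ‖(u ^ 2)⁻¹‖ₑ = pw ‖u‖ 2 := by
  have hx : 0 < ‖u‖ := norm_pos_iff.2 hu
  rw [← ofReal_norm, pw_eq hx, Real.rpow_neg hx.le, norm_inv, norm_pow]
  norm_cast

theorem K_int {Ω : Set ℂ} (hΩo : IsOpen Ω) {n : ℕ} (hn : 1 ≤ n) {z : ℂ} (hz : z ∈ Ω) :
    ∫⁻ ζ in Ω, ‖Kker Ω n z ζ‖ₑ ≤ n * XX Ω z := by
  have hO := hΩo.measurableSet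
  unfold XX
  rw [← lintegral_const_mul' _ _ (by simp)]
  apply setLIntegral_mono' hO
  intro ζ hζ
  rw [Kker_eq]
  refine (enorm_integral_le_lintegral_enorm _).trans ?_
  rw [← lintegral_const_mul _ (by fun_prop)]
  apply setLIntegral_mono' hO.compl
  intro w hw
  have h1 : z - w ≠ 0 := sub_ne_zero.2 (fun h => hw (h ▸ hz))
  have h2 : w - ζ ≠ 0 := sub_ne_zero.2 (fun h => hw (h ▸ hζ))
  rw [enorm_mul, inv_sq_enorm h1, kk_enorm hn _ h2, norm_sub_rev z w]
  exact le_of_eq (by ring)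

theorem K_far {Ω : Set ℂ} (hΩo : IsOpen Ω) {n : ℕ} (hn : 1 ≤ n) {z z' : ℂ} (hz : z ∈ Ω) (hz' : z' ∈ Ω) {h0 : ℝ} (hh0 : 0 < h0)
    (hzh : h0 ≤ infDist z (frontier Ω)) (hd : ‖z - z'‖ ≤ infDist z (frontier Ω) / 4) :
    ∫⁻ ζ in Ω, ‖Kker Ω n z ζ - Kker Ω n z' ζ‖ₑ ≤ ENNReal.ofReal (16 * ‖z - z'‖ / h0) * (n * XX Ω z) := by
  have hO := hΩo.measurableSet
  unfold XX
  rw [← lintegral_const_mul' _ _ (by simp), ← lintegral_const_mul' _ _ (by simp)]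
  apply setLIntegral_mono' hO
  intro ζ hζ
  rw [Kker_eq, Kker_eq, ← integral_sub (integrableOn_compl n hn hΩo hz hζ) (integrableOn_compl n hn hΩo hz' hζ)]
  refine (enorm_integral_le_lintegral_enorm _).trans ?_
  rw [← lintegral_const_mul _ (by fun_prop), ← lintegral_const_mul _ (by fun_prop)]
  apply setLIntegral_mono' hO.compl
  intro w hw
  have h2 : w - ζ ≠ 0 := sub_ne_zero.2 (fun h => hw (h ▸ hζ))
  rw [← sub_mul, enorm_mul, kk_enorm hn _ h2]
  have hwz : infDist z (frontier Ω) ≤ ‖w - z‖ := dist_le_left hΩo hz hw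
  have p1 : 0 < ‖w - z‖ := by linarith
  have hwz' : ‖w - z‖ / 2 ≤ ‖z' - w‖ := by
    have := norm_sub_le_norm_sub_add_norm_sub w z' z
    rw [norm_sub_rev w z', norm_sub_rev z' z] at this
    linarith
  have key := inv_sq_diff (m := ‖w - z‖ / 2) (by linarith) (z - w) (z' - w) (by rw [norm_sub_rev z w]; linarith) hwz'
  have key2 : ‖((z - w) ^ 2)⁻¹ - ((z' - w) ^ 2)⁻¹‖ₑ ≤ ENNReal.ofReal (16 * ‖z - z'‖ / h0) * pw ‖w - z‖ 2 := by
    rw [← ofReal_norm, pw_eq p1, ← ENNReal.ofReal_mul (by positivity)]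
    apply ENNReal.ofReal_le_ofReal
    refine key.trans ?_
    rw [Real.rpow_neg p1.le]
    norm_cast
    rw [sub_sub_sub_cancel_right, ← div_eq_mul_inv, div_div, div_le_div_iff₀ (by positivity) (by positivity)]
    have : 0 ≤ ‖z - z'‖ * ‖w - z‖ ^ 2 * (‖w - z‖ - h0) := by
      apply mul_nonneg (by positivity); linarith
    nlinarith
  calc _ ≤ (ENNReal.ofReal (16 * ‖z - z'‖ / h0) * pw ‖w - z‖ 2) * (n * pw ‖w - ζ‖ 2) := by gcongr
    _ = _ := by ring

theorem K_near {Ω : Set ℂ} (hΩo : IsOpen Ω) (hΩb : Bornology.IsBounded Ω) (hfne : (frontier Ω).Nonempty) {n : ℕ} (hn : 1 ≤ n)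
    {α ε N η : ℝ} (hα : 0 < α) (hα1 : α < 1) (hε : 0 < ε) (hN : 1 ≤ N) (hη : 0 < η) (hη1 : η ≤ 1/2)
    {C : ℝ≥0∞}
    (hC : ∀ a ∈ frontier Ω, ∀ e, ‖e‖ = 1 → FlatE Ω ε N a e → ∫⁻ ζ in Ω, TT Ω α η e a ζ ≤ C)
    (hF : ∀ b ∈ frontier Ω, Flat Ω ε N b) {z z' : ℂ} (hz : z ∈ Ω)
    (h0 : 2 * infDist z (frontier Ω) < 1 / N) (h0' : (2 * infDist z (frontier Ω)) ^ ε ≤ 1 / (8 * N))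
    (hd : ‖z - z'‖ ≤ infDist z (frontier Ω) / 4) (hpos : 0 < infDist z (frontier Ω)) :
    ∫⁻ ζ in Ω, ‖Kker Ω n z ζ - Kker Ω n z' ζ‖ₑ ≤
      ENNReal.ofReal (1728 * ‖z - z'‖ * infDist z (frontier Ω) ^ (α - 1)) * ENNReal.ofReal (200 * n * (n + 1)) * C := by
  rcases eq_or_ne z z' with hzz | hzz
  · subst hzz; simp
  have hdp : 0 < ‖z - z'‖ := norm_pos_iff.2 (sub_ne_zero.2 hzz)
  obtain ⟨a, ha, had⟩ := (frontier_compact hΩb).exists_infDist_eq_dist hfne z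
  set h := infDist z (frontier Ω) with hh
  rw [dist_eq_norm] at had
  have haΩ : a ∉ Ω := by
    have := ha
    rw [hΩo.frontier_eq] at this; exact this.2
  have hball : ∀ p, ‖p - z‖ < h → p ∈ Ω := by
    intro p hp
    by_contra hc
    have := dist_le_left hΩo hz hc
    linarith
  have hz' : z' ∈ Ω := hball z' (by rw [norm_sub_rev]; linarith)
  obtain ⟨e, he, hFe⟩ := hF a ha
  have hee : e * (starRingEnd ℂ) e = 1 := by
    rw [Complex.mul_conj, Complex.normSq_eq_norm_sq, he]; norm_num
  have hzy : (e * (z - a)).im ≤ -(h / 2) := by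
    set p := z + (3 / 4 * h : ℝ) * (Complex.I * (starRingEnd ℂ) e) with hp
    have hpz : ‖p - z‖ = 3 / 4 * h := by
      rw [hp, add_sub_cancel_left, norm_mul, norm_mul, Complex.norm_I, RCLike.norm_conj, he, Complex.norm_real,
        Real.norm_eq_abs, abs_of_pos (by linarith)]; ring
    have hpΩ := hball p (by linarith)
    have hpa : ‖p - a‖ ≤ 2 * h := by
      have := norm_sub_le_norm_sub_add_norm_sub p z a
      linarith
    have h1 := (hFe p (by linarith)).1 hpΩ
    have h2 : e * (p - a) = e * (z - a) + (3 / 4 * h : ℝ) * Complex.I := by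
      rw [hp]; linear_combination ((3 / 4 * h : ℝ) * Complex.I) * hee
    rw [h2] at h1
    have h3 : (e * (z - a) + (3 / 4 * h : ℝ) * Complex.I).im = (e * (z - a)).im + 3 / 4 * h := by
      rw [Complex.add_im, Complex.im_ofReal_mul, Complex.I_im, mul_one]
    rw [h3] at h1
    have h4 : ‖p - a‖ ^ (1 + ε) ≤ (2 * h) ^ (1 + ε) := Real.rpow_le_rpow (norm_nonneg _) hpa (by linarith)
    have h4e : (2 * h) ^ (1 + ε) = 2 * h * (2 * h) ^ ε := by
      rw [Real.rpow_add (by linarith), Real.rpow_one]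
    rw [h4e] at h4
    have h5 : N * ‖p - a‖ ^ (1 + ε) ≤ N * (2 * h * (1 / (8 * N))) := by
      have := mul_le_mul_of_nonneg_left h0' (by linarith : 0 ≤ 2 * h)
      gcongr
      linarith
    have h6 : N * (2 * h * (1 / (8 * N))) = h / 4 := by field_simp; norm_num
    linarith
  have him : ∀ p q : ℂ, |(e * (p - a)).im - (e * (q - a)).im| ≤ ‖p - q‖ := by
    intro p q
    have := Complex.abs_im_le_norm (e * (p - q))
    rw [norm_mul, he, one_mul] at this
    rw [← Complex.sub_im, ← mul_sub, sub_sub_sub_cancel_right]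
    exact this
  have hzy' : (e * (z' - a)).im < 0 := by
    have := (abs_le.1 (him z z')).1
    linarith
  have hB : ∀ w, w ∉ Ω ∨ w ∈ HP e a → ‖((z - w) ^ 2)⁻¹ - ((z' - w) ^ 2)⁻¹‖ₑ ≤
      ENNReal.ofReal (1728 * ‖z - z'‖ * h ^ (α - 1)) * pw ‖w - a‖ (2 + α) := by
    intro w hw
    have hwz : h / 2 ≤ ‖w - z‖ := by
      rcases hw with hw | hw
      · have := dist_le_left hΩo hz hw
        linarith
      · have h1 := (abs_le.1 (him w z)).2
        have h2 : 0 < (e * (w - a)).im := hw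
        linarith
    have hwz' : ‖w - z‖ / 2 ≤ ‖z' - w‖ := by
      have := norm_sub_le_norm_sub_add_norm_sub w z' z
      rw [norm_sub_rev w z', norm_sub_rev z' z] at this
      linarith
    have hwa : ‖w - a‖ ≤ 3 * ‖w - z‖ := by
      have := norm_sub_le_norm_sub_add_norm_sub w z a
      linarith
    have p1 : 0 < ‖w - z‖ := by linarith
    set m := ‖w - z‖ / 2 with hm
    have pm : 0 < m := by linarith
    have key := inv_sq_diff (m := m) pm (z - w) (z' - w) (by rw [norm_sub_rev z w]; linarith) hwz'
    rcases eq_or_ne w a with hwa0 | hwa0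
    · rw [hwa0, sub_self, norm_zero, pw_top le_rfl (by linarith), ENNReal.mul_top]
      · exact le_top
      · rw [ne_eq, ENNReal.ofReal_eq_zero, not_le]; positivity
    · have p2 : 0 < ‖w - a‖ := norm_pos_iff.2 (sub_ne_zero.2 hwa0)
      rw [← ofReal_norm, pw_eq p2, ← ENNReal.ofReal_mul (by positivity)]
      apply ENNReal.ofReal_le_ofReal
      refine key.trans ?_
      rw [sub_sub_sub_cancel_right]
      have e1 : m ^ 3 = m ^ (1 - α) * m ^ (2 + α) := by
        rw [← Real.rpow_add pm, show 1 - α + (2 + α) = ((3:ℕ):ℝ) by push_cast; ring, Real.rpow_natCast]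
      have e2 : (h / 4) ^ (1 - α) ≤ m ^ (1 - α) := Real.rpow_le_rpow (by linarith) (by linarith) (by linarith)
      have e3 : (‖w - a‖ / 6) ^ (2 + α) ≤ m ^ (2 + α) := Real.rpow_le_rpow (by positivity) (by linarith) (by linarith)
      rw [Real.div_rpow hpos.le (by norm_num)] at e2
      rw [Real.div_rpow p2.le (by norm_num)] at e3
      have e4 : (4:ℝ) ^ (1 - α) ≤ 4 := by
        calc (4:ℝ) ^ (1 - α) ≤ 4 ^ (1:ℝ) := Real.rpow_le_rpow_of_exponent_le (by norm_num) (by linarith)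
          _ = 4 := by norm_num
      have e5 : (6:ℝ) ^ (2 + α) ≤ 216 := by
        calc (6:ℝ) ^ (2 + α) ≤ 6 ^ (3:ℝ) := Real.rpow_le_rpow_of_exponent_le (by norm_num) (by linarith)
          _ = 216 := by norm_num
      have e6 : h ^ (α - 1) = (h ^ (1 - α))⁻¹ := by rw [← Real.rpow_neg hpos.le]; congr 1; ring
      have e7 : ‖w - a‖ ^ (-(2 + α)) = (‖w - a‖ ^ (2 + α))⁻¹ := Real.rpow_neg p2.le _
      have q1 : 0 < h ^ (1 - α) := by positivity
      have q2 : 0 < ‖w - a‖ ^ (2 + α) := by positivity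
      set X := h ^ (1 - α)
      set Y := ‖w - a‖ ^ (2 + α)
      have e8 : X / 4 ≤ m ^ (1 - α) := le_trans (by gcongr) e2
      have e9 : Y / 216 ≤ m ^ (2 + α) := le_trans (by gcongr) e3
      have e10 : X / 4 * (Y / 216) ≤ m ^ 3 := by rw [e1]; gcongr
      rw [e6, e7]
      calc 2 * ‖z - z'‖ / m ^ 3 ≤ 2 * ‖z - z'‖ / (X / 4 * (Y / 216)) := by gcongr
        _ = _ := by field_simp; norm_num
  have hpt : ∀ᵐ ζ ∂(volume.restrict Ω), ‖Kker Ω n z ζ - Kker Ω n z' ζ‖ₑ ≤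
      (ENNReal.ofReal (1728 * ‖z - z'‖ * h ^ (α - 1)) * ENNReal.ofReal (200 * n * (n + 1))) * TT Ω α η e a ζ := by
    filter_upwards [ae_restrict_mem hΩo.measurableSet, ae_restrict_of_ae (line_null e a he)] with ζ hζ hζy
    exact K_diff n hn hΩo he haΩ hz hz' hζ (by linarith) hzy' hζy hα hη.le (by linarith) _ hB
  refine (lintegral_mono_ae hpt).trans ?_
  rw [lintegral_const_mul' _ _ (ENNReal.mul_ne_top ENNReal.ofReal_ne_top ENNReal.ofReal_ne_top)]
  gcongr
  exact hC a ha e he hFe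



theorem ball_le_dist {Ω : Set ℂ} (hΩo : IsOpen Ω) (hfne : (frontier Ω).Nonempty) {z : ℂ} {r : ℝ} (h : ball z r ⊆ Ω) :
    r ≤ infDist z (frontier Ω) := by
  rw [le_infDist hfne]
  intro y hy
  by_contra hc
  have : y ∈ Ω := h (by rw [mem_ball, dist_comm]; linarith)
  rw [hΩo.frontier_eq] at hy
  exact hy.2 this

theorem dist_pos_of_mem {Ω : Set ℂ} (hΩo : IsOpen Ω) (hfne : (frontier Ω).Nonempty) {z : ℂ} (hz : z ∈ Ω) :
    0 < infDist z (frontier Ω) := by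
  obtain ⟨m, hm, h⟩ := Metric.isOpen_iff.1 hΩo z hz
  exact hm.trans_le (ball_le_dist hΩo hfne h)

theorem mem_of_dist {Ω : Set ℂ} (hΩo : IsOpen Ω) {z z' : ℂ} (hz : z ∈ Ω) (h : ‖z - z'‖ < infDist z (frontier Ω)) :
    z' ∈ Ω := by
  by_contra hc
  have := dist_le_left hΩo hz hc
  rw [norm_sub_rev] at this
  linarith

theorem p1_cons {A d δ α : ℝ} (hA : 0 ≤ A) (hα1 : α < 1) (hα : 0 < α) (hd : 0 ≤ d) (h : d ≤ δ) :
    A * d * δ ^ (α - 1) ≤ A * d ^ α := by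
  rcases hd.eq_or_lt with h0 | h0
  · rw [← h0]; simp [Real.zero_rpow hα.ne']
  · have : δ ^ (α - 1) ≤ d ^ (α - 1) := Real.rpow_le_rpow_of_nonpos h0 h (by linarith)
    have e : d ^ α = d * d ^ (α - 1) := by
      rw [Real.rpow_sub h0, Real.rpow_one]; field_simp
    rw [e, mul_assoc]
    gcongr

theorem chain {Ω : Set ℂ} {δ : ℂ → ℝ} {g : ℂ → ℂ} {A α : ℝ} (hA : 0 ≤ A) (hα : 0 < α) (hα1 : α < 1)
    (hδ : ∀ z ∈ Ω, 0 < δ z)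
    (hP : ∀ z ∈ Ω, ∀ z', ‖z - z'‖ ≤ δ z / 4 → ‖g z - g z'‖ ≤ A * ‖z - z'‖ * δ z ^ (α - 1))
    {z v : ℂ} (hz : z ∈ Ω) (hv : ‖v‖ = 1) {c T : ℝ} (hc : 0 < c) (hc1 : c ≤ 1) (hT : 0 < T)
    (H : ∀ t : ℝ, 0 < t → t ≤ T → z + t * v ∈ Ω ∧ c * t ≤ δ (z + t * v)) :
    ‖g z - g (z + T * v)‖ ≤ A * (1 / (1 - (1 - c / 4) ^ α) + 1) * T ^ α := by
  set l := 1 - c / 4 with hl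
  have hl0 : 0 < l := by rw [hl]; linarith
  have hl1 : l < 1 := by rw [hl]; linarith
  set q := l ^ α with hq
  have hq0 : 0 < q := Real.rpow_pos_of_pos hl0 _
  have hq1 : q < 1 := Real.rpow_lt_one hl0.le hl1 hα
  have step : ∀ t : ℝ, 0 < t → t ≤ T → ‖g (z + t * v) - g (z + (l * t : ℝ) * v)‖ ≤ A * t ^ α := by
    intro t ht htT
    obtain ⟨h1, h2⟩ := H t ht htT
    have e : ‖(z + t * v) - (z + (l * t : ℝ) * v)‖ = c * t / 4 := by
      have : (z + t * v) - (z + (l * t : ℝ) * v) = ((c * t / 4 : ℝ) : ℂ) * v := by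
        rw [hl]; push_cast; ring
      rw [this, norm_mul, hv, mul_one, Complex.norm_real, Real.norm_eq_abs, abs_of_pos (by positivity)]
    have h3 := hP _ h1 (z + (l * t : ℝ) * v) (by rw [e]; linarith)
    rw [e] at h3
    refine h3.trans ((p1_cons hA hα1 hα (by positivity) (by nlinarith [mul_pos hc ht])).trans ?_)
    gcongr
    nlinarith
  have ind : ∀ k : ℕ, ‖g (z + T * v) - g (z + (l ^ k * T : ℝ) * v)‖ ≤ A * T ^ α * (1 / (1 - q) * (1 - q ^ k)) := by
    intro k
    induction k with
    | zero => simp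
    | succ k ih =>
      have h1 : l ^ k * T ≤ T := by
        have : l ^ k ≤ 1 := pow_le_one₀ hl0.le hl1.le
        nlinarith
      have h2 := step (l ^ k * T) (by positivity) h1
      have e : l * (l ^ k * T) = l ^ (k + 1) * T := by ring
      rw [e, Real.mul_rpow (by positivity) hT.le] at h2
      have e2 : (l ^ k) ^ α = q ^ k := by
        rw [hq, ← Real.rpow_natCast, ← Real.rpow_natCast, ← Real.rpow_mul hl0.le, ← Real.rpow_mul hl0.le, mul_comm]
      rw [e2] at h2
      have e3 : A * T ^ α * (1 / (1 - q) * (1 - q ^ (k + 1))) = A * T ^ α * (1 / (1 - q) * (1 - q ^ k)) + A * (q ^ k * T ^ α) := by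
        have : 1 - q ≠ 0 := by linarith
        field_simp
        ring
      rw [e3]
      exact (norm_sub_le_norm_sub_add_norm_sub _ (g (z + (l ^ k * T : ℝ) * v)) _).trans (add_le_add ih h2)
  obtain ⟨k, hk⟩ := exists_pow_lt_of_lt_one (show 0 < δ z / 4 / T from div_pos (by linarith [hδ z hz]) hT) hl1
  rw [lt_div_iff₀ hT] at hk
  have e : ‖z - (z + (l ^ k * T : ℝ) * v)‖ = l ^ k * T := by
    rw [sub_add_cancel_left, norm_neg, norm_mul, hv, mul_one, Complex.norm_real, Real.norm_eq_abs, abs_of_pos (by positivity)]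
  have h1 := hP z hz (z + (l ^ k * T : ℝ) * v) (by rw [e]; exact hk.le)
  rw [e] at h1
  have h2 := h1.trans (p1_cons hA hα1 hα (by positivity) (by linarith [hδ z hz]))
  have h3 : (l ^ k * T) ^ α ≤ T ^ α := by
    have : l ^ k ≤ 1 := pow_le_one₀ hl0.le hl1.le
    apply Real.rpow_le_rpow (by positivity) (by nlinarith) hα.le
  have h4 := ind k
  have h5 : A * T ^ α * (1 / (1 - q) * (1 - q ^ k)) ≤ A * T ^ α * (1 / (1 - q)) := by
    have : 0 < 1 - q := by linarith
    have : 0 < q ^ k := by positivity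
    apply mul_le_mul_of_nonneg_left _ (by positivity)
    apply mul_le_of_le_one_right (by positivity) (by linarith)
  have h6 := norm_sub_le_norm_sub_add_norm_sub (g z) (g (z + (l ^ k * T : ℝ) * v)) (g (z + T * v))
  rw [norm_sub_rev (g (z + (l ^ k * T : ℝ) * v))] at h6
  have h7 := mul_le_mul_of_nonneg_left h3 hA
  calc _ ≤ A * T ^ α + A * T ^ α * (1 / (1 - q)) := by linarith
    _ = _ := by ring

set_option maxHeartbeats 1000000 in
theorem holder_chain {Ω : Set ℂ} (hΩo : IsOpen Ω) (hΩb : Bornology.IsBounded Ω) (hfne : (frontier Ω).Nonempty)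
    {α N : ℝ} (hα : 0 < α) (hα1 : α < 1) (hN : 1 ≤ N) (hCone : ∀ b ∈ frontier Ω, Cone Ω N b) :
    ∃ h1 > 0, ∃ K > 0, ∀ (g : ℂ → ℂ) (A B : ℝ), 0 ≤ A → 0 ≤ B →
      (∀ z ∈ Ω, ∀ z', ‖z - z'‖ ≤ infDist z (frontier Ω) / 4 → ‖g z - g z'‖ ≤ A * ‖z - z'‖ * infDist z (frontier Ω) ^ (α - 1)) →
      (∀ z ∈ Ω, h1 ≤ infDist z (frontier Ω) → ‖g z‖ ≤ B) →
      (∀ z ∈ Ω, ‖g z‖ ≤ K * (A + B)) ∧ ∀ z ∈ Ω, ∀ z' ∈ Ω, ‖g z - g z'‖ ≤ K * (A + B) * ‖z - z'‖ ^ α := by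
  have hN0 : 0 < N := by linarith
  set δ := fun z => infDist z (frontier Ω) with hδd
  have hδ : ∀ z ∈ Ω, 0 < δ z := fun z hz => dist_pos_of_mem hΩo hfne hz
  set K0 := 1 / (1 - (1 - 1 / N / 4) ^ α) + 1 with hK0
  have hNi : 0 < 1 / N := by positivity
  have hNi1 : 1 / N ≤ 1 := by rw [div_le_one hN0]; exact hN
  have hq1 : (1 - 1 / N / 4) ^ α < 1 := Real.rpow_lt_one (by linarith) (by linarith) hα
  have hK01 : 1 ≤ K0 := by
    have : 0 < 1 / (1 - (1 - 1 / N / 4) ^ α) := by apply div_pos one_pos; linarith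
    rw [hK0]; linarith
  set h1 := 1 / N * (1 / N) / 2 with hh1
  have hh10 : 0 < h1 := by positivity
  have hh1N : h1 < 1 / N := by nlinarith
  set r1 := 1 / N * (1 / N) / 8 with hr1
  have hr10 : 0 < r1 := by positivity
  have near : ∀ z, ∃ b ∈ frontier Ω, ‖z - b‖ = δ z := by
    intro z
    obtain ⟨a, ha, had⟩ := (frontier_compact hΩb).exists_infDist_eq_dist hfne z
    exact ⟨a, ha, by rw [← dist_eq_norm]; exact had.symm⟩
  set K1 := 1 + 2 * K0 * (4 * N) ^ α with hK1
  have hK10 : 1 ≤ K1 := by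
    have : 0 ≤ 2 * K0 * (4 * N) ^ α := by positivity
    linarith
  have hrp : 0 < r1 ^ α := Real.rpow_pos_of_pos hr10 _
  refine ⟨h1, hh10, K0 + K1 + 2 * K0 / r1 ^ α, by positivity, fun g A B hA hB hP hQ => ?_⟩
  have ch : ∀ b ∈ frontier Ω, ∃ v : ℂ, ‖v‖ = 1 ∧ ∀ z ∈ Ω, ‖z - b‖ < 1 / N → ∀ T, 0 < T → T ≤ 1 / N →
      z + T * v ∈ Ω ∧ 1 / N * T ≤ δ (z + T * v) ∧ ‖g z - g (z + T * v)‖ ≤ A * K0 * T ^ α := by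
    intro b hb
    obtain ⟨v, hv, H⟩ := hCone b hb
    refine ⟨v, hv, fun z hz hzb T hT hTN => ?_⟩
    have H' : ∀ t : ℝ, 0 < t → t ≤ T → z + t * v ∈ Ω ∧ 1 / N * t ≤ δ (z + t * v) := by
      intro t ht htT
      have hb := H z hz hzb t ht.le (htT.trans hTN)
      refine ⟨hb (mem_ball_self (by positivity)), ?_⟩
      have := ball_le_dist hΩo hfne hb
      rw [one_div_mul_eq_div]; exact this
    refine ⟨(H' T hT le_rfl).1, (H' T hT le_rfl).2, ?_⟩
    exact chain hA hα hα1 hδ hP hz hv hNi hNi1 hT H'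
  have S : ∀ z ∈ Ω, ‖g z‖ ≤ K0 * (A + B) := by
    intro z hz
    by_cases hc : h1 ≤ δ z
    · refine (hQ z hz hc).trans ?_
      nlinarith
    · push Not at hc
      obtain ⟨b, hb, hzb⟩ := near z
      obtain ⟨v, hv, H⟩ := ch b hb
      obtain ⟨m1, m2, m3⟩ := H z hz (by linarith) (1 / N) hNi le_rfl
      have := hQ _ m1 (by refine le_trans ?_ m2; rw [hh1]; nlinarith)
      have t1 : (1 / N) ^ α ≤ 1 := Real.rpow_le_one hNi.le hNi1 hα.le
      have t2 : A * K0 * (1 / N) ^ α ≤ A * K0 := mul_le_of_le_one_right (by positivity) t1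
      have t3 := norm_le_norm_sub_add (g z) (g (z + (1 / N : ℝ) * v))
      nlinarith
  have hAB : 0 ≤ A + B := by linarith
  refine ⟨fun z hz => (S z hz).trans ?_, fun z hz z' hz' => ?_⟩
  · have : 0 ≤ K1 + 2 * K0 / r1 ^ α := by positivity
    apply mul_le_mul_of_nonneg_right _ hAB
    linarith
  set d := ‖z - z'‖ with hd
  have hd0 : 0 ≤ d := norm_nonneg _
  have hda : 0 ≤ d ^ α := by positivity
  have big : ∀ X, ‖g z - g z'‖ ≤ X * (A + B) * d ^ α → X ≤ K0 + K1 + 2 * K0 / r1 ^ α →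
      ‖g z - g z'‖ ≤ (K0 + K1 + 2 * K0 / r1 ^ α) * (A + B) * d ^ α := by
    intro X h1 h2
    refine h1.trans ?_
    gcongr
  have p3 : 0 ≤ 2 * K0 / r1 ^ α := by positivity
  by_cases c1 : d ≤ δ z / 4
  · apply big K1 _ (by linarith)
    refine (hP z hz z' c1).trans ((p1_cons hA hα1 hα hd0 (by linarith [hδ z hz])).trans ?_)
    gcongr
    nlinarith
  push Not at c1
  by_cases c2 : r1 ≤ d
  · apply big (2 * K0 / r1 ^ α) _ (by linarith)
    have t1 : ‖g z - g z'‖ ≤ 2 * (K0 * (A + B)) := by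
      have := norm_sub_le (g z) (g z')
      linarith [S z hz, S z' hz']
    have t2 : r1 ^ α ≤ d ^ α := Real.rpow_le_rpow hr10.le c2 hα.le
    refine t1.trans ?_
    rw [div_mul_eq_mul_div, div_mul_eq_mul_div, le_div_iff₀ hrp]
    rw [← mul_assoc]
    gcongr
  push Not at c2
  apply big K1 _ (by linarith)
  have hdp : 0 < d := by linarith [hδ z hz]
  obtain ⟨b, hb, hzb⟩ := near z
  obtain ⟨v, hv, H⟩ := ch b hb
  have hr1N : r1 ≤ 1 / N / 8 := by rw [hr1]; nlinarith
  have hT : 4 * N * d ≤ 1 / N := by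
    have : 4 * N * d ≤ 4 * N * r1 := by gcongr
    have e : 4 * N * r1 = 1 / N / 2 := by rw [hr1]; field_simp; norm_num
    linarith
  obtain ⟨m1, m2, m3⟩ := H z hz (by linarith) (4 * N * d) (by positivity) hT
  have hz'b : ‖z' - b‖ < 1 / N := by
    have := norm_sub_le_norm_sub_add_norm_sub z' z b
    rw [norm_sub_rev z' z] at this
    linarith
  obtain ⟨m1', m2', m3'⟩ := H z' hz' hz'b (4 * N * d) (by positivity) hT
  have e : 1 / N * (4 * N * d) = 4 * d := by field_simp
  rw [e] at m2
  have ed : ‖(z + (4 * N * d : ℝ) * v) - (z' + (4 * N * d : ℝ) * v)‖ = d := by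
    rw [add_sub_add_right_eq_sub]
  have m4 := hP _ m1 (z' + (4 * N * d : ℝ) * v) (by rw [ed]; change _ ≤ δ _ / 4; linarith)
  rw [ed] at m4
  have m5 := m4.trans (p1_cons hA hα1 hα hd0 (by change _ ≤ δ _; linarith))
  rw [Real.mul_rpow (by positivity) hd0] at m3 m3'
  have n1 := norm_sub_le_norm_sub_add_norm_sub (g z) (g (z + (4 * N * d : ℝ) * v)) (g z')
  have n2 := norm_sub_le_norm_sub_add_norm_sub (g (z + (4 * N * d : ℝ) * v)) (g (z' + (4 * N * d : ℝ) * v)) (g z')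
  rw [norm_sub_rev (g (z' + (4 * N * d : ℝ) * v))] at n2
  calc ‖g z - g z'‖ ≤ A * K1 * d ^ α := by rw [hK1]; linarith
    _ ≤ K1 * (A + B) * d ^ α := by
      apply mul_le_mul_of_nonneg_right _ hda
      nlinarith



theorem Kker_meas {Ω : Set ℂ} (n : ℕ) (z : ℂ) : StronglyMeasurable (fun ζ => Kker Ω n z ζ) := by
  simp only [Kker_eq]
  have hm := measurable_kk n
  have : StronglyMeasurable (fun p : ℂ × ℂ => ((z - p.2) ^ 2)⁻¹ * kk n (p.2 - p.1)) := by
    apply Measurable.stronglyMeasurable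
    have : Measurable (fun p : ℂ × ℂ => kk n (p.2 - p.1)) := hm.comp (by fun_prop)
    fun_prop
  exact this.integral_prod_right

theorem K_all {Ω : Set ℂ} (hΩo : IsOpen Ω) (hne : Ω.Nonempty) (hΩb : Bornology.IsBounded Ω) {n : ℕ} (hn : 1 ≤ n)
    {α ε : ℝ} (hα : 0 < α) (hαε : α < ε) (hε1 : ε < 1) (hΩ : HasC1HolderBoundaryC ε Ω) :
    (∃ C : ℝ, 0 ≤ C ∧ ∀ z ∈ Ω, ∀ z', ‖z - z'‖ ≤ infDist z (frontier Ω) / 4 →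
      ∫⁻ ζ in Ω, ‖Kker Ω n z ζ - Kker Ω n z' ζ‖ₑ ≤ ENNReal.ofReal (C * ‖z - z'‖ * infDist z (frontier Ω) ^ (α - 1))) ∧
    ∀ h1 : ℝ, 0 < h1 → ∃ C : ℝ, 0 ≤ C ∧ ∀ z ∈ Ω, h1 ≤ infDist z (frontier Ω) →
      ∫⁻ ζ in Ω, ‖Kker Ω n z ζ‖ₑ ≤ ENNReal.ofReal C := by
  have hε : 0 < ε := hα.trans hαε
  have hα1 : α < 1 := hαε.trans hε1
  have hfne := frontier_ne hΩo hne hΩb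
  have hI := dist_int hΩo hne hΩb hε hΩ
  obtain ⟨N, hN, hG⟩ := geometry hΩo hΩb hε hΩ
  have hN0 : 0 < N := by linarith
  obtain ⟨D, hD0, hD⟩ : ∃ D : ℝ, 0 < D ∧ ∀ a ∈ frontier Ω, Ω ⊆ closedBall a D := by
    refine ⟨diam (closure Ω) + 1, by linarith [diam_nonneg (s := closure Ω)], fun a ha x hx => ?_⟩
    rw [mem_closedBall]
    have := dist_le_diam_of_mem hΩb.closure (subset_closure hx) (frontier_subset_closure ha)
    linarith
  have hvol : volume Ω < ⊤ := hΩb.measure_lt_top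
  set α' := (α + ε) / 2 with hα'
  set η := (α' - α) / (2 * (2 + α')) with hη'
  have hη : 0 < η := by apply div_pos <;> linarith
  have hη2 : η ≤ (α' - α) / 4 := by
    apply div_le_div_of_nonneg_left <;> linarith
  have hηc : (2 + α) / (2 + (α + ε) / 2) + η / (1/2) = 1 := by
    rw [← hα', hη']
    have : 2 + α' ≠ 0 := by linarith
    field_simp
    ring
  have hη1 : η ≤ 1 / 2 := by linarith
  obtain ⟨C, hC, HC⟩ := TT_int hΩo hvol hα hαε hε1 hN hη hη1 (by linarith) hηc hI hD0 hD
  have X := fun h1 (hh1 : (0:ℝ) < h1) => XX_bound hΩo hΩb hfne hη hη1 hI hD0 hD hh1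
  constructor
  swap
  · intro h1 hh1
    obtain ⟨C', hC', H⟩ := X h1 hh1
    refine ⟨((n : ℝ≥0∞) * C').toReal, ENNReal.toReal_nonneg, fun z hz hzh => ?_⟩
    rw [ENNReal.ofReal_toReal (ENNReal.mul_ne_top (by simp) hC'.ne)]
    refine (K_int hΩo hn hz).trans ?_
    gcongr
    exact H z hz hzh
  obtain ⟨h0, hh0, hA, hB⟩ : ∃ h0 : ℝ, 0 < h0 ∧ 2 * h0 < 1 / N ∧ (2 * h0) ^ ε ≤ 1 / (8 * N) := by
    have t : Tendsto (fun h : ℝ => (2 * h) ^ ε) (𝓝 0) (𝓝 ((2 * (0:ℝ)) ^ ε)) := by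
      have : ContinuousAt (fun h : ℝ => (2 * h) ^ ε) 0 := by
        apply ContinuousAt.rpow_const (by fun_prop) (Or.inr hε.le)
      exact this
    rw [mul_zero, Real.zero_rpow hε.ne'] at t
    have t1 := t.eventually (eventually_le_nhds (show (0:ℝ) < 1 / (8 * N) by positivity))
    have t2 : ∀ᶠ h : ℝ in 𝓝 0, 2 * h < 1 / N := by
      have : Tendsto (fun h : ℝ => 2 * h) (𝓝 0) (𝓝 (2 * 0)) := by
        apply Continuous.tendsto; fun_prop
      rw [mul_zero] at this
      exact this.eventually (eventually_lt_nhds (show (0:ℝ) < 1 / N by positivity))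
    have t3 : ∀ᶠ h : ℝ in 𝓝[>] 0, 0 < h := eventually_mem_nhdsWithin
    obtain ⟨h, ha, hb, hc⟩ := (t3.and ((t2.and t1).filter_mono nhdsWithin_le_nhds)).exists
    exact ⟨h, ha, hb, hc⟩
  obtain ⟨C', hC', H⟩ := X h0 hh0
  set P := (ENNReal.ofReal (200 * n * (n + 1)) * C).toReal with hP
  have hPn : 0 ≤ P := ENNReal.toReal_nonneg
  have hPe : ENNReal.ofReal P = ENNReal.ofReal (200 * n * (n + 1)) * C :=
    ENNReal.ofReal_toReal (ENNReal.mul_ne_top ENNReal.ofReal_ne_top hC.ne)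
  set Q := ((n : ℝ≥0∞) * C').toReal with hQ
  have hQn : 0 ≤ Q := ENNReal.toReal_nonneg
  have hQe : ENNReal.ofReal Q = n * C' := ENNReal.ofReal_toReal (ENNReal.mul_ne_top (by simp) hC'.ne)
  have hDa : 0 < D ^ (1 - α) := Real.rpow_pos_of_pos hD0 _
  refine ⟨1728 * P + 16 / h0 * D ^ (1 - α) * Q, by positivity, fun z hz z' hd => ?_⟩
  have hpos := dist_pos_of_mem hΩo hfne hz
  set δ := infDist z (frontier Ω) with hδ
  have hδa : 0 < δ ^ (α - 1) := Real.rpow_pos_of_pos hpos _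
  rcases le_total δ h0 with hc | hc
  · have := K_near hΩo hΩb hfne hn hα hα1 hε hN hη hη1 HC (fun b hb => (hG b hb).1) hz (z' := z') (by linarith)
      ((Real.rpow_le_rpow (by positivity) (by linarith) hε.le).trans hB) hd hpos
    refine this.trans ?_
    rw [mul_assoc, ← hPe, ← ENNReal.ofReal_mul (by positivity)]
    apply ENNReal.ofReal_le_ofReal
    have : 0 ≤ 16 / h0 * D ^ (1 - α) * Q * (‖z - z'‖ * δ ^ (α - 1)) := by positivity
    rw [← hδ]
    linarith
  · have hz' : z' ∈ Ω := mem_of_dist hΩo hz (by linarith)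
    refine (K_far hΩo hn hz hz' hh0 hc hd).trans ?_
    have h1 : (n : ℝ≥0∞) * XX Ω z ≤ ENNReal.ofReal Q := by
      rw [hQe]; gcongr; exact H z hz hc
    refine (mul_le_mul_right h1 _).trans ?_
    rw [← ENNReal.ofReal_mul (by positivity)]
    apply ENNReal.ofReal_le_ofReal
    have h2 : 1 ≤ D ^ (1 - α) * δ ^ (α - 1) := by
      obtain ⟨a, ha⟩ := hfne
      have hδD : δ ≤ D := (infDist_le_dist_of_mem ha).trans (hD a ha hz)
      have : δ ^ (1 - α) ≤ D ^ (1 - α) := Real.rpow_le_rpow hpos.le hδD (by linarith)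
      have e : δ ^ (1 - α) * δ ^ (α - 1) = 1 := by
        rw [← Real.rpow_add hpos]; simp
      exact e.symm.le.trans (mul_le_mul_of_nonneg_right this hδa.le)
    have h3 : 0 ≤ 16 / h0 * Q * ‖z - z'‖ := by positivity
    have h4 := mul_le_mul_of_nonneg_left h2 h3
    have h5 : 0 ≤ 1728 * P * (‖z - z'‖ * δ ^ (α - 1)) := by positivity
    have e1 : 16 * ‖z - z'‖ / h0 * Q = 16 / h0 * Q * ‖z - z'‖ * 1 := by ring
    rw [e1]
    linarith

theorem int_bound {Ω : Set ℂ} (hO : MeasurableSet Ω) {k f : ℂ → ℂ} {M c : ℝ} (hc : 0 ≤ c) (hM0 : 0 ≤ M)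
    (hM : ∀ ζ ∈ Ω, ‖f ζ‖ ≤ M) (hk : ∫⁻ ζ in Ω, ‖k ζ‖ₑ ≤ ENNReal.ofReal c) :
    ‖∫ ζ in Ω, k ζ * f ζ‖ ≤ c * M ∧ ∫⁻ ζ in Ω, ‖k ζ * f ζ‖ₑ ≤ ENNReal.ofReal (c * M) := by
  have h : ∫⁻ ζ in Ω, ‖k ζ * f ζ‖ₑ ≤ ENNReal.ofReal (c * M) := by
    calc _ ≤ ∫⁻ ζ in Ω, ‖k ζ‖ₑ * ENNReal.ofReal M := by
          apply setLIntegral_mono' hO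
          intro ζ hζ
          rw [enorm_mul]
          gcongr
          rw [← ofReal_norm]
          exact ENNReal.ofReal_le_ofReal (hM ζ hζ)
      _ ≤ _ := by
          rw [lintegral_mul_const' _ _ (by simp), ENNReal.ofReal_mul hc]
          gcongr
  refine ⟨?_, h⟩
  have := (enorm_integral_le_lintegral_enorm _).trans h
  rw [← ofReal_norm] at this
  exact (ENNReal.ofReal_le_ofReal_iff (by positivity)).1 this

theorem final (ε : ℝ) (n : ℕ) (hn : 1 ≤ n) (hε1 : ε < 1)
    (Ω : Set ℂ) (hΩo : IsOpen Ω) (hne : Ω.Nonempty)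
    (hΩb : Bornology.IsBounded Ω) (hΩ : HasC1HolderBoundaryC ε Ω) (α : ℝ) (hα : 0 < α) (hαε : α < ε) :
      ∃ C : ℝ, 0 < C ∧
        ∀ f : ℂ → ℂ, Measurable f → ∀ M : ℝ, (∀ ζ ∈ Ω, ‖f ζ‖ ≤ M) →
          holderNorm α Ω (fun z => ∫ ζ in Ω, Kker Ω n z ζ * f ζ) ≤
            ENNReal.ofReal (C * M) := by
  have hε : 0 < ε := hα.trans hαε
  have hα1 : α < 1 := hαε.trans hε1
  have hO := hΩo.measurableSet
  have hfne := frontier_ne hΩo hne hΩb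
  obtain ⟨N, hN, hG⟩ := geometry hΩo hΩb hε hΩ
  obtain ⟨h1, hh1, K, hK, HK⟩ := holder_chain hΩo hΩb hfne hα hα1 hN (fun b hb => (hG b hb).2)
  obtain ⟨⟨A, hA, HA⟩, hall⟩ := K_all hΩo hne hΩb hn hα hαε hε1 hΩ
  obtain ⟨B, hB, HB⟩ := hall h1 hh1
  refine ⟨2 * K * (A + B + 1), by positivity, fun f hf M hM => ?_⟩
  obtain ⟨z0, hz0⟩ := hne
  have hM0 : 0 ≤ M := (norm_nonneg _).trans (hM z0 hz0)
  set g := fun z => ∫ ζ in Ω, Kker Ω n z ζ * f ζ with hg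
  have hintg : ∀ z ∈ Ω, IntegrableOn (fun ζ => Kker Ω n z ζ * f ζ) Ω := by
    intro z hz
    obtain ⟨B', hB', HB'⟩ := hall _ (dist_pos_of_mem hΩo hfne hz)
    refine ⟨((Kker_meas n z).mul hf.stronglyMeasurable).aestronglyMeasurable, ?_⟩
    exact ((int_bound hO hB' hM0 hM (HB' z hz le_rfl)).2).trans_lt ENNReal.ofReal_lt_top
  obtain ⟨S, T⟩ := HK g (A * M) (B * M) (by positivity) (by positivity) (by
    intro z hz z' hd
    have hp := dist_pos_of_mem hΩo hfne hz
    have hz' : z' ∈ Ω := mem_of_dist hΩo hz (by linarith)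
    have := (int_bound hO (by positivity) hM0 hM (HA z hz z' hd)).1
    have e : g z - g z' = ∫ ζ in Ω, (Kker Ω n z ζ - Kker Ω n z' ζ) * f ζ := by
      rw [hg]
      simp only [sub_mul]
      rw [integral_sub (hintg z hz) (hintg z' hz')]
    rw [e]
    refine this.trans (le_of_eq (by ring))) (by
    intro z hz hzh
    exact (int_bound hO hB hM0 hM (HB z hz hzh)).1)
  set R := K * (A * M + B * M) with hR
  have hR0 : 0 ≤ R := by positivity
  have hRR : ENNReal.ofReal R + ENNReal.ofReal R ≤ ENNReal.ofReal (2 * K * (A + B + 1) * M) := by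
    rw [← ENNReal.ofReal_add hR0 hR0]
    apply ENNReal.ofReal_le_ofReal
    have : 0 ≤ K * M := by positivity
    rw [hR]; linarith
  refine le_trans ?_ hRR
  unfold holderNorm
  apply add_le_add
  · apply iSup_le
    intro x
    have := S x.1 x.2
    change ‖g x.1‖ₑ ≤ _
    rw [← ofReal_norm]
    exact ENNReal.ofReal_le_ofReal this
  · apply iSup_le
    intro p
    apply ENNReal.ofReal_le_ofReal
    exact div_le_of_le_mul₀ (by positivity) hR0 (T _ p.1.2 _ p.2.2)

/-- For a bounded `C^{1+ε}` domain `Ω ⊆ ℂ` and `n ≥ 1`, the operator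
`P(f)(z) = ∫_Ω K_n(z,ζ)f(ζ)dA(ζ)` satisfies `‖P(f)‖_{α,Ω} ≤ C ‖f‖_{L^∞(Ω)}` for every
`0 < α < ε` and every bounded measurable `f`, with `C = C(n,α,ε,Ω)`. -/
theorem statement12 (ε : ℝ) (hε0 : 0 < ε) (hε1 : ε < 1) (n : ℕ) (hn : 1 ≤ n)
    (Ω : Set ℂ) (hΩo : IsOpen Ω) (hΩc : IsConnected Ω)
    (hΩb : Bornology.IsBounded Ω) (hΩ : HasC1HolderBoundaryC ε Ω) :
    ∀ α : ℝ, 0 < α → α < ε →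
      ∃ C : ℝ, 0 < C ∧
        ∀ f : ℂ → ℂ, Measurable f → ∀ M : ℝ, (∀ ζ ∈ Ω, ‖f ζ‖ ≤ M) →
          holderNorm α Ω (fun z => ∫ ζ in Ω, Kker Ω n z ζ * f ζ) ≤
            ENNReal.ofReal (C * M) := by
  intro α hα hαε
  exact final ε n hn hε1 Ω hΩo hΩc.nonempty hΩb hΩ α hα hαε

end
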